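/- There exists a computable function f from lists of lists of pairs of integers to the natural numbers such that whenever a list L encodes a critical update family 𝒰 (each inner list enumerating the elements of one rule of 𝒰), f(L) equals the difficulty α(𝒰) (which is a finite natural number for every critical update family). -/

import Mathlib

open scoped Classical

/-- A site of the two-dimensional lattice. -/
abbrev Site : Type := ℤ × ℤ

/-- An update family: a finite nonempty collection of finite nonempty rules,
none containing the origin. We represent the collection as a `Finset (Finset Site)`
together with this well-formedness predicate. -/
def IsUpdateFamily (𝒰 : Finset (Finset Site)) : Prop :=
  𝒰.Nonempty ∧ ∀ U ∈ 𝒰, U.Nonempty ∧ ((0, 0) : Site) ∉ U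

/-- One step of the bootstrap percolation dynamics. -/
def bpStep (𝒰 : Finset (Finset Site)) (A : Set Site) : Set Site :=
  A ∪ {x : Site | ∃ U ∈ 𝒰, ∀ y ∈ U, x + y ∈ A}

/-- The configuration after `t` steps of the dynamics started from `A`. -/
def bpIter (𝒰 : Finset (Finset Site)) (A : Set Site) : ℕ → Set Site
  | 0 => A
  | n + 1 => bpStep 𝒰 (bpIter 𝒰 A n)

/-- The closure `[A]` of a set `A` under the bootstrap dynamics. -/
def bpClosure (𝒰 : Finset (Finset Site)) (A : Set Site) : Set Site :=
  ⋃ n : ℕ, bpIter 𝒰 A n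

/-- The unit circle `S¹ ⊆ ℝ²`. -/
def sphere2 : Set (ℝ × ℝ) := {u : ℝ × ℝ | u.1 ^ 2 + u.2 ^ 2 = 1}

/-- Inner product of a lattice site with a real vector. -/
def inner2 (x : Site) (u : ℝ × ℝ) : ℝ := (x.1 : ℝ) * u.1 + (x.2 : ℝ) * u.2

/-- The open half-plane `H_u` with outer normal `u`. -/
def halfPlane (u : ℝ × ℝ) : Set Site := {x : Site | inner2 x u < 0}

/-- The lattice line `l_u` through the origin perpendicular to `u`. -/
def lineu (u : ℝ × ℝ) : Set Site := {x : Site | inner2 x u = 0}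

/-- A direction `u` is unstable if some rule lies in `H_u`. -/
def Unstable (𝒰 : Finset (Finset Site)) (u : ℝ × ℝ) : Prop :=
  ∃ U ∈ 𝒰, (U : Set Site) ⊆ halfPlane u

/-- A direction of the unit circle is stable if it is not unstable. -/
def Stable (𝒰 : Finset (Finset Site)) (u : ℝ × ℝ) : Prop :=
  u ∈ sphere2 ∧ ¬ Unstable 𝒰 u

/-- The set of stable directions. -/
def stableSet (𝒰 : Finset (Finset Site)) : Set (ℝ × ℝ) := {u | Stable 𝒰 u}

/-- An isolated stable direction: a stable direction not in the (topological)
closure of the set of other stable directions. -/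
def IsolatedStable (𝒰 : Finset (Finset Site)) (u : ℝ × ℝ) : Prop :=
  Stable 𝒰 u ∧ u ∉ closure (stableSet 𝒰 \ {u})

/-- The open semicircle of the unit circle centred at the direction `v`. -/
def openSemicircle (v : ℝ × ℝ) : Set (ℝ × ℝ) :=
  {u ∈ sphere2 | 0 < u.1 * v.1 + u.2 * v.2}

/-- A family is supercritical if some open semicircle consists of unstable directions. -/
def Supercritical (𝒰 : Finset (Finset Site)) : Prop :=
  ∃ v ∈ sphere2, ∀ u ∈ openSemicircle v, Unstable 𝒰 u

/-- A family is critical if it is not supercritical and some open semicircle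
contains only finitely many stable directions. -/
def Critical (𝒰 : Finset (Finset Site)) : Prop :=
  ¬ Supercritical 𝒰 ∧ ∃ v ∈ sphere2, (stableSet 𝒰 ∩ openSemicircle v).Finite

/-- The difficulty `α(u)` of a direction: `0` for unstable directions, `∞` for
non-isolated stable directions, and for isolated stable directions the minimum
cardinality of a finite `Z ⊆ ℤ² ∖ H_u` such that `[H_u ∪ Z] ∖ H_u` is infinite. -/
noncomputable def dirDifficulty (𝒰 : Finset (Finset Site)) (u : ℝ × ℝ) : ℕ∞ :=
  if Unstable 𝒰 u then 0
  else if IsolatedStable 𝒰 u then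
    sInf {n : ℕ∞ | ∃ Z : Finset Site, (∀ z ∈ Z, z ∉ halfPlane u) ∧
      (bpClosure 𝒰 (halfPlane u ∪ (Z : Set Site)) \ halfPlane u).Infinite ∧ n = Z.card}
  else ⊤

/-- The difficulty `α(𝒰)` of an update family. -/
noncomputable def difficulty (𝒰 : Finset (Finset Site)) : ℕ∞ :=
  ⨅ v ∈ sphere2, ⨆ u ∈ openSemicircle v, dirDifficulty 𝒰 u

/-- The diameter `D` of an update family: `2 · max{‖x‖_∞ : x ∈ ⋃ U ∈ 𝒰, U}`. -/
def famDiam (𝒰 : Finset (Finset Site)) : ℕ :=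
  2 * 𝒰.sup (fun U => U.sup (fun x => max x.1.natAbs x.2.natAbs))

/-- A list of lists of integer pairs encodes an update family if the rules of the
family are exactly the `toFinset`s of the inner lists. -/
def Encodes (L : List (List (ℤ × ℤ))) (𝒰 : Finset (Finset Site)) : Prop :=
  𝒰 = (L.map List.toFinset).toFinset

attribute [fun_prop] Primrec

namespace Primrec

variable {α β γ : Type} [Primcodable α] [Primcodable β] [Primcodable γ]

@[fun_prop] lemma fp_id : Primrec fun a : α => a := Primrec.id
@[fun_prop] lemma fp_const (b : β) : Primrec fun _ : α => b := Primrec.const b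
@[fun_prop] lemma fp_comp {f : β → γ} {g : α → β} (hf : Primrec f) (hg : Primrec g) :
    Primrec fun a => f (g a) := hf.comp hg
@[fun_prop] lemma fp_fst {f : α → β × γ} (hf : Primrec f) : Primrec fun a => (f a).1 :=
  Primrec.fst.comp hf
@[fun_prop] lemma fp_snd {f : α → β × γ} (hf : Primrec f) : Primrec fun a => (f a).2 :=
  Primrec.snd.comp hf
@[fun_prop] lemma fp_mk {f : α → β} {g : α → γ} (hf : Primrec f) (hg : Primrec g) :
    Primrec fun a => (f a, g a) := hf.pair hg
@[fun_prop] lemma fp_cons {f : α → β} {g : α → List β} (hf : Primrec f) (hg : Primrec g) :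
    Primrec fun a => f a :: g a := Primrec.list_cons.comp hf hg
@[fun_prop] lemma fp_append {f g : α → List β} (hf : Primrec f) (hg : Primrec g) :
    Primrec fun a => f a ++ g a := Primrec.list_append.comp hf hg
@[fun_prop] lemma fp_length {f : α → List β} (hf : Primrec f) :
    Primrec fun a => (f a).length := Primrec.list_length.comp hf
@[fun_prop] lemma fp_nat_add {f g : α → ℕ} (hf : Primrec f) (hg : Primrec g) :
    Primrec fun a => f a + g a := Primrec.nat_add.comp hf hg
@[fun_prop] lemma fp_nat_mul {f g : α → ℕ} (hf : Primrec f) (hg : Primrec g) :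
    Primrec fun a => f a * g a := Primrec.nat_mul.comp hf hg

lemma int_encode (z : ℤ) :
    Encodable.encode z = if 0 ≤ z then 2 * z.toNat else 2 * ((-z).toNat - 1) + 1 := by
  cases z with
  | ofNat n =>
    have h : 0 ≤ Int.ofNat n := Int.natCast_nonneg n
    rw [if_pos h]
    rfl
  | negSucc n =>
    have : ¬ (0 ≤ Int.negSucc n) := by simp
    simp [Encodable.encode, Equiv.intEquivNat, Equiv.intEquivNatSumNat, Int.neg_negSucc]

lemma int_subNat : Primrec fun p : ℕ × ℕ => (p.1 : ℤ) - p.2 := by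
  refine Primrec.encode_iff.1 ?_
  have : Primrec fun p : ℕ × ℕ =>
      if p.2 ≤ p.1 then 2 * (p.1 - p.2) else 2 * ((p.2 - p.1) - 1) + 1 := by
    refine Primrec.ite (Primrec.nat_le.comp .snd .fst) ?_ ?_
    · exact Primrec.nat_mul.comp (.const 2) (Primrec.nat_sub.comp .fst .snd)
    · exact Primrec.succ.comp (Primrec.nat_mul.comp (.const 2)
        (Primrec.nat_sub.comp (Primrec.nat_sub.comp .snd .fst) (.const 1)))
  refine this.of_eq fun p => ?_
  rw [int_encode]
  split_ifs <;> omega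

lemma int_toNat : Primrec Int.toNat := by
  have : Primrec fun z : ℤ => if Encodable.encode z % 2 = 0 then Encodable.encode z / 2 else 0 := by
    refine Primrec.ite (Primrec.eq.comp (Primrec.nat_mod.comp .encode (.const 2)) (.const 0)) ?_ ?_
    · exact Primrec.nat_div.comp .encode (.const 2)
    · exact .const 0
  refine this.of_eq fun z => ?_
  rw [int_encode]
  split_ifs <;> omega

lemma int_negToNat : Primrec fun z : ℤ => (-z).toNat := by
  have : Primrec fun z : ℤ => if Encodable.encode z % 2 = 0 then 0 else
      Encodable.encode z / 2 + 1 := by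
    refine Primrec.ite (Primrec.eq.comp (Primrec.nat_mod.comp .encode (.const 2)) (.const 0)) ?_ ?_
    · exact .const 0
    · exact Primrec.succ.comp (Primrec.nat_div.comp .encode (.const 2))
  refine this.of_eq fun z => ?_
  rw [int_encode]
  split_ifs <;> omega

@[fun_prop] lemma fp_natCast {f : α → ℕ} (hf : Primrec f) : Primrec fun a => (f a : ℤ) :=
  (int_subNat.comp (hf.pair (.const 0))).of_eq fun a => by simp

@[fun_prop] lemma fp_int_neg {f : α → ℤ} (hf : Primrec f) : Primrec fun a => - f a :=
  (int_subNat.comp ((int_negToNat.comp hf).pair (int_toNat.comp hf))).of_eq fun a => by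
    dsimp only; omega

@[fun_prop] lemma fp_int_add {f g : α → ℤ} (hf : Primrec f) (hg : Primrec g) :
    Primrec fun a => f a + g a :=
  (int_subNat.comp ((Primrec.nat_add.comp (int_toNat.comp hf) (int_toNat.comp hg)).pair
    (Primrec.nat_add.comp (int_negToNat.comp hf) (int_negToNat.comp hg)))).of_eq fun a => by
    dsimp only; omega

@[fun_prop] lemma fp_int_sub {f g : α → ℤ} (hf : Primrec f) (hg : Primrec g) :
    Primrec fun a => f a - g a := by
  simpa only [sub_eq_add_neg] using fp_int_add hf (fp_int_neg hg)

@[fun_prop] lemma fp_int_mul {f g : α → ℤ} (hf : Primrec f) (hg : Primrec g) :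
    Primrec fun a => f a * g a := by
  have hf1 := int_toNat.comp hf
  have hf2 := int_negToNat.comp hf
  have hg1 := int_toNat.comp hg
  have hg2 := int_negToNat.comp hg
  refine (int_subNat.comp ((fp_nat_add (fp_nat_mul hf1 hg1) (fp_nat_mul hf2 hg2)).pair
    (fp_nat_add (fp_nat_mul hf1 hg2) (fp_nat_mul hf2 hg1)))).of_eq fun a => ?_
  have h1 : f a = ((f a).toNat : ℤ) - ((- f a).toNat : ℤ) := by omega
  have h2 : g a = ((g a).toNat : ℤ) - ((- g a).toNat : ℤ) := by omega
  conv_rhs => rw [h1, h2]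
  push_cast
  ring

end Primrec

namespace PrimrecPred

variable {α β : Type} [Primcodable α] [Primcodable β]

lemma ex_mem {f : α → List β} {p : α → β → Prop} (hf : Primrec f)
    (hp : PrimrecPred fun q : α × β => p q.1 q.2) : PrimrecPred fun a => ∃ b ∈ f a, p a b := by
  have h : PrimrecRel fun (b : β) (a : α) => p a b :=
    hp.comp (Primrec.snd.pair Primrec.fst)
  exact h.exists_mem_list.comp hf Primrec.id

lemma all_mem {f : α → List β} {p : α → β → Prop} (hf : Primrec f)
    (hp : PrimrecPred fun q : α × β => p q.1 q.2) : PrimrecPred fun a => ∀ b ∈ f a, p a b := by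
  have h : PrimrecRel fun (b : β) (a : α) => p a b :=
    hp.comp (Primrec.snd.pair Primrec.fst)
  exact h.forall_mem_list.comp hf Primrec.id

lemma all_lt {f : α → ℕ} {p : α → ℕ → Prop} (hf : Primrec f)
    (hp : PrimrecPred fun q : α × ℕ => p q.1 q.2) : PrimrecPred fun a => ∀ n < f a, p a n := by
  exact (all_mem (Primrec.list_range.comp hf) hp).of_eq fun a => by simp

lemma mem_list {f : α → List β} {g : α → β} (hf : Primrec f) (hg : Primrec g) :
    PrimrecPred fun a => g a ∈ f a :=
  (ex_mem (p := fun a b => b = g a) hf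
    (Primrec.eq.comp Primrec.snd (hg.comp Primrec.fst))).of_eq fun a => by simp

lemma imp {p q : α → Prop} (hp : PrimrecPred p) (hq : PrimrecPred q) :
    PrimrecPred fun a => p a → q a := (hp.not.or hq).of_eq fun a => by tauto

lemma eq' {f g : α → β} (hf : Primrec f) (hg : Primrec g) : PrimrecPred fun a => f a = g a :=
  Primrec.eq.comp hf hg

lemma ne' {f g : α → β} (hf : Primrec f) (hg : Primrec g) : PrimrecPred fun a => f a ≠ g a :=
  (eq' hf hg).not

lemma nat_le' {f g : α → ℕ} (hf : Primrec f) (hg : Primrec g) : PrimrecPred fun a => f a ≤ g a :=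
  Primrec.nat_le.comp hf hg

lemma nat_lt' {f g : α → ℕ} (hf : Primrec f) (hg : Primrec g) : PrimrecPred fun a => f a < g a :=
  Primrec.nat_lt.comp hf hg

lemma int_le {f g : α → ℤ} (hf : Primrec f) (hg : Primrec g) : PrimrecPred fun a => f a ≤ g a :=
  (eq' (Primrec.int_toNat.comp (Primrec.fp_int_sub hf hg)) (Primrec.const 0)).of_eq
    fun a => by omega

lemma int_lt {f g : α → ℤ} (hf : Primrec f) (hg : Primrec g) : PrimrecPred fun a => f a < g a :=
  (int_le hg hf).not.of_eq fun a => by omega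

end PrimrecPred

/-- A set of sites is closed if no rule adds a site to it. -/
def BpClosed (𝒰 : Finset (Finset Site)) (A : Set Site) : Prop :=
  ∀ U ∈ 𝒰, ∀ x, (∀ y ∈ U, x + y ∈ A) → x ∈ A

section Closure

variable {𝒰 : Finset (Finset Site)} {A B : Set Site}

lemma bpIter_mono_time : Monotone (bpIter 𝒰 A) :=
  monotone_nat_of_le_succ fun _ => Set.subset_union_left

lemma subset_bpClosure : A ⊆ bpClosure 𝒰 A := fun _ hx => Set.mem_iUnion.2 ⟨0, hx⟩

lemma bpClosed_bpClosure : BpClosed 𝒰 (bpClosure 𝒰 A) := by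
  intro U hU x hx
  have h : ∀ y : U, ∃ n, x + y.1 ∈ bpIter 𝒰 A n := fun y => Set.mem_iUnion.1 (hx y y.2)
  choose n hn using h
  refine Set.mem_iUnion.2 ⟨(Finset.univ.sup n) + 1, Or.inr ⟨U, hU, fun y hy => ?_⟩⟩
  exact bpIter_mono_time (Finset.le_sup (Finset.mem_univ ⟨y, hy⟩)) (hn ⟨y, hy⟩)

lemma bpClosure_subset (hB : BpClosed 𝒰 B) (h : A ⊆ B) : bpClosure 𝒰 A ⊆ B := by
  refine Set.iUnion_subset fun n => ?_
  induction n with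
  | zero => exact h
  | succ n ih =>
    rintro x (hx | ⟨U, hU, hx⟩)
    · exact ih hx
    · exact hB U hU x fun y hy => ih (hx y hy)

lemma bpClosure_mono (h : A ⊆ B) : bpClosure 𝒰 A ⊆ bpClosure 𝒰 B :=
  bpClosure_subset bpClosed_bpClosure (h.trans subset_bpClosure)

lemma bpClosed_shift (hB : BpClosed 𝒰 B) (s : Site) : BpClosed 𝒰 {x | x + s ∈ B} := by
  intro U hU x hx
  refine hB U hU (x + s) fun y hy => ?_
  rw [add_right_comm]
  exact hx y hy

lemma bpClosure_shift {s : Site} (h : ∀ a ∈ A, a + s ∈ bpClosure 𝒰 B) {x : Site}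
    (hx : x ∈ bpClosure 𝒰 A) : x + s ∈ bpClosure 𝒰 B :=
  bpClosure_subset (bpClosed_shift bpClosed_bpClosure s) h hx

end Closure

/-- The integer inner product. -/
def height (t x : Site) : ℤ := x.1 * t.1 + x.2 * t.2

/-- The open half-plane with integer normal vector. -/
def intHalfPlane (t : Site) : Set Site := {x | height t x < 0}

/-- The vector obtained by a quarter turn. -/
def quarterTurn (t : Site) : Site := (-t.2, t.1)

/-- Stability of an integer direction. -/
def IntStable (𝒰 : Finset (Finset Site)) (t : Site) : Prop := ∀ U ∈ 𝒰, ∃ x ∈ U, 0 ≤ height t x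

/-- The sup-norm distance of two sites. -/
def siteDist (x y : Site) : ℕ := max (x.1 - y.1).natAbs (x.2 - y.2).natAbs

/-- The sites within distance `r` of `Z`. -/
def siteNhd (Z : Set Site) (r : ℕ) : Set Site := {w | ∃ z ∈ Z, siteDist w z ≤ r}

lemma height_add (t x y : Site) : height t (x + y) = height t x + height t y := by
  simp only [height, Prod.fst_add, Prod.snd_add]; ring

lemma height_sub (t x y : Site) : height t (x - y) = height t x - height t y := by
  simp only [height, Prod.fst_sub, Prod.snd_sub]; ring

lemma height_neg (t x : Site) : height t (-x) = - height t x := by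
  simp only [height, Prod.fst_neg, Prod.snd_neg]; ring

lemma height_smul (t x : Site) (n : ℤ) : height t (n • x) = n * height t x := by
  simp only [height, Prod.smul_fst, Prod.smul_snd, smul_eq_mul]; ring

lemma height_quarterTurn (t : Site) : height t (quarterTurn t) = 0 := by
  simp only [height, quarterTurn]; ring

lemma height_self_pos {t : Site} (ht : t ≠ 0) : 0 < height t t := by
  have : t.1 ≠ 0 ∨ t.2 ≠ 0 := by
    by_contra! h
    exact ht (Prod.ext h.1 h.2)
  simp only [height]
  rcases this with h | h <;> have := mul_self_pos.2 h <;> nlinarith [mul_self_nonneg t.1,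
    mul_self_nonneg t.2]

lemma siteDist_comm (x y : Site) : siteDist x y = siteDist y x := by
  simp only [siteDist]; omega

lemma siteDist_self (x : Site) : siteDist x x = 0 := by simp [siteDist]

lemma siteDist_triangle (x y z : Site) : siteDist x z ≤ siteDist x y + siteDist y z := by
  simp only [siteDist]; omega

lemma siteDist_add_right (x y s : Site) : siteDist (x + s) (y + s) = siteDist x y := by
  simp [siteDist]

lemma siteDist_add_left (x y s : Site) : siteDist (s + x) (s + y) = siteDist x y := by
  simp [siteDist]

lemma abs_mul_le_mul_self (a b : ℤ) (n : ℤ) (h : |a| ≤ n) : |a * b| ≤ n * (b * b) := by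
  rw [abs_mul]
  have h1 : |b| ≤ b * b := by
    rw [← abs_mul_abs_self b]
    rcases eq_or_ne b 0 with rfl | hb
    · simp
    · have := Int.one_le_abs hb
      nlinarith
  have := abs_nonneg a
  nlinarith [abs_nonneg b, mul_self_nonneg b]

lemma abs_height_le (t x : Site) {r : ℕ} (h : siteDist x 0 ≤ r) :
    |height t x| ≤ r * height t t := by
  simp only [siteDist, Prod.fst_zero, Prod.snd_zero] at h
  have h1 := abs_mul_le_mul_self x.1 t.1 r (abs_le.2 (by omega))
  have h2 := abs_mul_le_mul_self x.2 t.2 r (abs_le.2 (by omega))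
  simp only [height]
  calc _ ≤ |x.1 * t.1| + |x.2 * t.2| := abs_add_le _ _
    _ ≤ _ := by linarith

lemma abs_height_sub_le (t x y : Site) {r : ℕ} (h : siteDist x y ≤ r) :
    |height t x - height t y| ≤ r * height t t := by
  rw [← height_sub]
  refine abs_height_le t _ (le_trans (le_of_eq ?_) h)
  simp [siteDist]

lemma siteDist_zero_le_of_height {t : Site} (ht : t ≠ 0) (x : Site) {a b : ℕ}
    (ha : |height (quarterTurn t) x| ≤ a) (hb : |height t x| ≤ b) : siteDist x 0 ≤ a + b := by
  have hN := height_self_pos ht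
  have key : ∀ c u v : ℤ, c * height t t = height t x * u + height (quarterTurn t) x * v →
      (u * u ≤ height t t) → (v * v ≤ height t t) → |c| ≤ a + b := by
    intro c u v h hu hv
    have h1 := abs_mul_le_mul_self _ u _ hb
    have h2 := abs_mul_le_mul_self _ v _ ha
    have h3 : |c| * height t t ≤ (a + b) * height t t := by
      rw [← abs_of_pos hN, ← abs_mul, h, abs_of_pos hN]
      calc _ ≤ _ := abs_add_le _ _
        _ ≤ b * (u * u) + a * (v * v) := add_le_add h1 h2
        _ ≤ b * height t t + a * height t t := by gcongr
        _ = _ := by ring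
    exact le_of_mul_le_mul_right h3 hN
  have k1 := key x.1 t.1 (-t.2) (by simp only [height, quarterTurn]; ring)
    (by simp only [height]; nlinarith [mul_self_nonneg t.2])
    (by simp only [height]; nlinarith [mul_self_nonneg t.1])
  have k2 := key x.2 t.2 t.1 (by simp only [height, quarterTurn]; ring)
    (by simp only [height]; nlinarith [mul_self_nonneg t.1])
    (by simp only [height]; nlinarith [mul_self_nonneg t.2])
  simp only [siteDist, Prod.fst_zero, Prod.snd_zero]
  rw [abs_le] at k1 k2
  omega

lemma bpClosed_intHalfPlane_le {𝒰 : Finset (Finset Site)} {t : Site} (hst : IntStable 𝒰 t) (c : ℤ) :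
    BpClosed 𝒰 {x | height t x < c} := by
  intro U hU x hx
  obtain ⟨y, hy, hy0⟩ := hst U hU
  have := hx y hy
  simp only [Set.mem_ofPred_eq, height_add] at this ⊢
  omega

lemma bpClosed_intHalfPlane {𝒰 : Finset (Finset Site)} {t : Site} (hst : IntStable 𝒰 t) :
    BpClosed 𝒰 (intHalfPlane t) := bpClosed_intHalfPlane_le hst 0

/-- The closure of a set together with a half-plane. -/
def halfClosure (𝒰 : Finset (Finset Site)) (t : Site) (Z : Set Site) : Set Site :=
  bpClosure 𝒰 (intHalfPlane t ∪ Z)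

/-- The closure of `Z` and the half-plane stays close to `Z`. -/
def ClosureNear (𝒰 : Finset (Finset Site)) (t : Site) (r : ℕ) (Z : Set Site) : Prop :=
  halfClosure 𝒰 t Z ⊆ intHalfPlane t ∪ siteNhd Z r

lemma siteNhd_mono {Z Z' : Set Site} {r r' : ℕ} (h : Z ⊆ Z') (hr : r ≤ r') :
    siteNhd Z r ⊆ siteNhd Z' r' := fun _ ⟨z, hz, hd⟩ => ⟨z, h hz, hd.trans hr⟩

section HalfClosure

variable {𝒰 : Finset (Finset Site)} {t : Site} {D r : ℕ}

lemma ClosureNear.mono {Z : Set Site} {r' : ℕ} (h : ClosureNear 𝒰 t r Z) (hr : r ≤ r') :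
    ClosureNear 𝒰 t r' Z :=
  h.trans (Set.union_subset_union_right _ (siteNhd_mono subset_rfl hr))

lemma intHalfPlane_subset_halfClosure {Z : Set Site} : intHalfPlane t ⊆ halfClosure 𝒰 t Z :=
  Set.subset_union_left.trans subset_bpClosure

lemma subset_halfClosure {Z : Set Site} : Z ⊆ halfClosure 𝒰 t Z :=
  Set.subset_union_right.trans subset_bpClosure

lemma halfClosure_subset {Z W : Set Site} (hW : BpClosed 𝒰 (intHalfPlane t ∪ W)) (h : Z ⊆ W) :
    halfClosure 𝒰 t Z ⊆ intHalfPlane t ∪ W :=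
  bpClosure_subset hW (Set.union_subset_union_right _ h)

lemma halfClosure_empty (hst : IntStable 𝒰 t) : halfClosure 𝒰 t ∅ = intHalfPlane t := by
  refine (bpClosure_subset (bpClosed_intHalfPlane hst) ?_).antisymm intHalfPlane_subset_halfClosure
  simp

lemma halfClosure_shift {Z W : Set Site} {s : Site} (hs : height t s = 0)
    (h : ∀ z ∈ Z, z + s ∈ halfClosure 𝒰 t W) {x : Site} (hx : x ∈ halfClosure 𝒰 t Z) :
    x + s ∈ halfClosure 𝒰 t W := by
  refine bpClosure_shift (fun a ha => ?_) hx
  rcases ha with ha | ha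
  · refine subset_bpClosure (Or.inl ?_)
    simpa only [intHalfPlane, Set.mem_ofPred_eq, height_add, hs, add_zero] using ha
  · exact h a ha

lemma closureNear_empty (hst : IntStable 𝒰 t) : ClosureNear 𝒰 t r ∅ := by
  rw [ClosureNear, halfClosure_empty hst]
  exact Set.subset_union_left

/-- Far apart sets whose closures stay nearby do not interact. -/
lemma ClosureNear.union (hst : IntStable 𝒰 t) (hD : ∀ U ∈ 𝒰, ∀ y ∈ U, siteDist y 0 ≤ D)
    {Z₁ Z₂ : Set Site} (h₁ : ClosureNear 𝒰 t r Z₁) (h₂ : ClosureNear 𝒰 t r Z₂)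
    (hfar : ∀ z₁ ∈ Z₁, ∀ z₂ ∈ Z₂, 2 * r + 2 * D < siteDist z₁ z₂) :
    ClosureNear 𝒰 t r (Z₁ ∪ Z₂) := by
  have aux : ∀ {Y₁ Y₂ : Set Site}, ClosureNear 𝒰 t r Y₁ → ClosureNear 𝒰 t r Y₂ →
      (∀ z₁ ∈ Y₁, ∀ z₂ ∈ Y₂, 2 * r + 2 * D < siteDist z₁ z₂) → ∀ U ∈ 𝒰, ∀ x,
      (∀ y ∈ U, x + y ∈ halfClosure 𝒰 t Y₁ ∪ halfClosure 𝒰 t Y₂) → ∀ y₀ ∈ U,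
      x + y₀ ∉ intHalfPlane t → x + y₀ ∈ halfClosure 𝒰 t Y₁ → x ∈ halfClosure 𝒰 t Y₁ := by
    intro Y₁ Y₂ g₁ g₂ hfar U hU x hx y₀ hy₀ hn hy₁
    refine bpClosed_bpClosure U hU x fun y hy => ?_
    rcases hx y hy with h | h
    · exact h
    by_contra hcon
    rcases g₁ hy₁ with g | ⟨z₁, hz₁, hd₁⟩
    · exact hn g
    rcases g₂ h with g | ⟨z₂, hz₂, hd₂⟩
    · exact hcon (intHalfPlane_subset_halfClosure g)
    have e1 := hfar z₁ hz₁ z₂ hz₂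
    have e2 := siteDist_triangle z₁ (x + y₀) z₂
    have e3 := siteDist_triangle (x + y₀) (x + y) z₂
    have e4 := siteDist_triangle y₀ 0 y
    have e5 := hD U hU y hy
    have e6 := hD U hU y₀ hy₀
    rw [siteDist_comm] at hd₁ e5
    rw [siteDist_add_left] at e3
    omega
  have hcl : BpClosed 𝒰 (halfClosure 𝒰 t Z₁ ∪ halfClosure 𝒰 t Z₂) := by
    intro U hU x hx
    by_cases hxH : x ∈ intHalfPlane t
    · exact Or.inl (intHalfPlane_subset_halfClosure hxH)
    have : ∃ y ∈ U, x + y ∉ intHalfPlane t := by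
      by_contra! hcon
      exact hxH (bpClosed_intHalfPlane hst U hU x hcon)
    obtain ⟨y₀, hy₀, hn⟩ := this
    rcases hx y₀ hy₀ with h | h
    · exact Or.inl (aux h₁ h₂ hfar U hU x hx y₀ hy₀ hn h)
    · refine Or.inr (aux h₂ h₁ (fun a ha b hb => ?_) U hU x (fun y hy => (hx y hy).symm) y₀ hy₀ hn h)
      rw [siteDist_comm]
      exact hfar b hb a ha
  have hsub : halfClosure 𝒰 t (Z₁ ∪ Z₂) ⊆ halfClosure 𝒰 t Z₁ ∪ halfClosure 𝒰 t Z₂ := by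
    refine bpClosure_subset hcl ?_
    rintro x (hx | hx | hx)
    · exact Or.inl (intHalfPlane_subset_halfClosure hx)
    · exact Or.inl (subset_halfClosure hx)
    · exact Or.inr (subset_halfClosure hx)
  refine hsub.trans (Set.union_subset (h₁.trans ?_) (h₂.trans ?_)) <;>
    refine Set.union_subset_union_right _ (siteNhd_mono ?_ le_rfl)
  · exact Set.subset_union_left
  · exact Set.subset_union_right

lemma ClosureNear.of_shift {Z : Set Site} {s : Site} (hs : height t s = 0)
    (h : ClosureNear 𝒰 t r {x | x - s ∈ Z}) : ClosureNear 𝒰 t r Z := by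
  intro x hx
  have := h (halfClosure_shift (s := s) hs (fun z hz => subset_halfClosure (by simpa using hz)) hx)
  rcases this with h | ⟨z, hz, hd⟩
  · left
    simpa only [intHalfPlane, Set.mem_ofPred_eq, height_add, hs, add_zero] using h
  · refine Or.inr ⟨z - s, hz, ?_⟩
    rw [← siteDist_add_right _ _ s]
    simpa using hd

/-- A closed set that is high above the half-plane does not interact with it. -/
lemma bpClosed_union_of_high (hst : IntStable 𝒰 t) (hD : ∀ U ∈ 𝒰, ∀ y ∈ U, siteDist y 0 ≤ D)
    {W : Set Site} (hW : BpClosed 𝒰 W) (hh : ∀ w ∈ W, 2 * D * height t t < height t w) :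
    BpClosed 𝒰 (intHalfPlane t ∪ W) := by
  intro U hU x hx
  by_cases hxH : x ∈ intHalfPlane t
  · exact Or.inl hxH
  have : ∃ y ∈ U, x + y ∉ intHalfPlane t := by
    by_contra! hcon
    exact hxH (bpClosed_intHalfPlane hst U hU x hcon)
  obtain ⟨y₀, hy₀, hn⟩ := this
  have h₀ := hh _ ((hx y₀ hy₀).resolve_left hn)
  refine Or.inr (hW U hU x fun y hy => (hx y hy).resolve_left ?_)
  have e1 := abs_le.1 (abs_height_le t _ (hD U hU y hy))
  have e2 := abs_le.1 (abs_height_le t _ (hD U hU y₀ hy₀))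
  rw [height_add] at h₀
  simp only [intHalfPlane, Set.mem_ofPred_eq, height_add]
  linarith

lemma ClosureNear.of_lower (ht : t ≠ 0) (hst : IntStable 𝒰 t)
    (hD : ∀ U ∈ 𝒰, ∀ y ∈ U, siteDist y 0 ≤ D)
    {Z : Set Site} {s : Site} (hs : height t s ≤ 0) (h : ClosureNear 𝒰 t r {x | x - s ∈ Z})
    (hh : ∀ z ∈ Z, (r + 2 * D) * height t t < height t (z + s)) : ClosureNear 𝒰 t r Z := by
  have hN := height_self_pos ht
  set Z' : Set Site := {x | x - s ∈ Z} with hZ'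
  set W : Set Site := halfClosure 𝒰 t Z' \ intHalfPlane t with hWdef
  have hWnear : W ⊆ siteNhd Z' r := fun w hw => (h hw.1).resolve_left hw.2
  have hWh : ∀ w ∈ W, 2 * D * height t t < height t w := by
    intro w hw
    obtain ⟨z, hz, hd⟩ := hWnear hw
    have e1 := hh _ hz
    rw [sub_add_cancel] at e1
    have e2 := abs_le.1 (abs_height_sub_le t _ _ hd)
    linarith
  have hWc : BpClosed 𝒰 W := by
    intro U hU x hx
    refine ⟨bpClosed_bpClosure U hU x fun y hy => (hx y hy).1, ?_⟩
    by_contra hxH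
    obtain ⟨y, hy, hy0⟩ := hst U hU
    have e1 := hWh _ (hx y hy)
    have e2 := abs_le.1 (abs_height_le t _ (hD U hU y hy))
    rw [height_add] at e1
    simp only [intHalfPlane, Set.mem_ofPred_eq] at hxH
    have : (0 : ℤ) ≤ D * height t t := by positivity
    linarith
  have hcl := bpClosed_union_of_high hst hD (bpClosed_shift hWc s) (fun w hw => by
    have := hWh _ hw
    rw [height_add] at this
    linarith)
  refine (halfClosure_subset hcl fun z hz => ?_).trans (Set.union_subset_union_right _ ?_)
  · have hz' : z + s ∈ Z' := by simpa [hZ'] using hz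
    refine ⟨subset_halfClosure hz', ?_⟩
    have := hh z hz
    have : (0 : ℤ) ≤ (r + 2 * D) * height t t := by positivity
    simp only [intHalfPlane, Set.mem_ofPred_eq]
    linarith
  · intro w hw
    obtain ⟨z, hz, hd⟩ := hWnear hw
    refine ⟨z - s, hz, ?_⟩
    rw [← siteDist_add_right _ _ s]
    simpa using hd

end HalfClosure

/-- A finite set of large diameter splits into two parts which are far apart. -/
lemma exists_split {Z : Finset Site} {k r : ℕ} (hk : Z.card ≤ k) {p q : Site} (hp : p ∈ Z)
    (hq : q ∈ Z) (hpq : k * r < siteDist p q) :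
    ∃ Z₁ Z₂ : Finset Site, Z = Z₁ ∪ Z₂ ∧ Z₁.card < Z.card ∧ Z₂.card < Z.card ∧
      ∀ z₁ ∈ Z₁, ∀ z₂ ∈ Z₂, r < siteDist z₁ z₂ := by
  by_cases h : ∃ i < k, ∀ z ∈ Z, ¬ (i * r < siteDist p z ∧ siteDist p z ≤ (i + 1) * r)
  · obtain ⟨i, hi, h⟩ := h
    refine ⟨Z.filter fun z => siteDist p z ≤ i * r, Z.filter fun z => ¬ siteDist p z ≤ i * r,
      (Finset.filter_union_filter_not_eq _ _).symm, ?_, ?_, ?_⟩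
    · refine Finset.card_lt_card (Finset.filter_ssubset.2 ⟨q, hq, ?_⟩)
      have : i * r ≤ k * r := Nat.mul_le_mul_right r hi.le
      omega
    · refine Finset.card_lt_card (Finset.filter_ssubset.2 ⟨p, hp, ?_⟩)
      simp [siteDist_self]
    · intro z₁ hz₁ z₂ hz₂
      rw [Finset.mem_filter] at hz₁ hz₂
      have h2 := h z₂ hz₂.1
      have h3 := siteDist_triangle p z₁ z₂
      rw [add_mul, one_mul] at h2
      omega
  · exfalso
    push Not at h
    choose! z hz hz' using h
    have hinj : Set.InjOn z (Finset.range k) := by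
      intro i hi j hj hij
      simp only [Finset.coe_range, Set.mem_Iio] at hi hj
      have h1 := hz' i hi
      have h2 := hz' j hj
      rw [hij] at h1
      have e1 : i < j + 1 := lt_of_mul_lt_mul_right (h1.1.trans_le h2.2) (Nat.zero_le r)
      have e2 : j < i + 1 := lt_of_mul_lt_mul_right (h2.1.trans_le h1.2) (Nat.zero_le r)
      omega
    have hmaps : ∀ i ∈ Finset.range k, z i ∈ Z.erase p := by
      intro i hi
      rw [Finset.mem_range] at hi
      refine Finset.mem_erase.2 ⟨fun he => ?_, hz i hi⟩
      have := (hz' i hi).1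
      rw [he, siteDist_self] at this
      omega
    have := Finset.card_le_card_of_injOn z hmaps hinj
    rw [Finset.card_range, Finset.card_erase_of_mem hp] at this
    have := Finset.card_pos.2 ⟨p, hp⟩
    omega

/-- Closures of sets of fewer than `k` sites above the half-plane stay within distance `r`. -/
def NearBelow (𝒰 : Finset (Finset Site)) (t : Site) (k r : ℕ) : Prop :=
  ∀ Z : Finset Site, Z.card < k → (∀ z ∈ Z, 0 ≤ height t z) → ClosureNear 𝒰 t r Z

section NearBelow

variable {𝒰 : Finset (Finset Site)} {t : Site} {D : ℕ}

lemma NearBelow.step (hst : IntStable 𝒰 t) (hD : ∀ U ∈ 𝒰, ∀ y ∈ U, siteDist y 0 ≤ D)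
    {k r r' : ℕ} (hr : r ≤ r') (h : NearBelow 𝒰 t k r)
    (hclust : ∀ Z : Finset Site, Z.card = k → (∀ z ∈ Z, 0 ≤ height t z) →
      (∀ p ∈ Z, ∀ q ∈ Z, siteDist p q ≤ k * (2 * r + 2 * D)) → ClosureNear 𝒰 t r' Z) :
    NearBelow 𝒰 t (k + 1) r' := by
  intro Z hZ hpos
  rcases (Nat.lt_succ_iff_lt_or_eq.1 hZ) with hlt | heq
  · exact (h Z hlt hpos).mono hr
  by_cases hdiam : ∀ p ∈ Z, ∀ q ∈ Z, siteDist p q ≤ k * (2 * r + 2 * D)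
  · exact hclust Z heq hpos hdiam
  push Not at hdiam
  obtain ⟨p, hp, q, hq, hpq⟩ := hdiam
  obtain ⟨Z₁, Z₂, rfl, h₁, h₂, hfar⟩ := exists_split heq.le hp hq hpq
  rw [Finset.coe_union]
  refine ((h Z₁ (heq ▸ h₁) fun z hz => hpos z (Finset.mem_union_left _ hz)).union hst hD
    (h Z₂ (heq ▸ h₂) fun z hz => hpos z (Finset.mem_union_right _ hz)) hfar).mono hr

lemma exists_normalize (ht : t ≠ 0) (z : Site) : ∃ i : ℤ,
    0 ≤ height (quarterTurn t) (z + i • quarterTurn t) ∧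
      height (quarterTurn t) (z + i • quarterTurn t) < height t t := by
  have hN := height_self_pos ht
  have he : height (quarterTurn t) (quarterTurn t) = height t t := by
    simp only [height, quarterTurn]; ring
  refine ⟨-(height (quarterTurn t) z / height t t), ?_⟩
  rw [height_add, height_smul, he]
  have h1 := Int.emod_nonneg (height (quarterTurn t) z) hN.ne'
  have h2 := Int.emod_lt_of_pos (height (quarterTurn t) z) hN
  have h3 := Int.emod_add_mul_ediv (height (quarterTurn t) z) (height t t)
  constructor <;> linarith

lemma coe_image_add (Z : Finset Site) (s : Site) :
    ((Z.image (· + s) : Finset Site) : Set Site) = {x | x - s ∈ (Z : Set Site)} := by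
  ext x
  simp only [Finset.coe_image, Set.mem_image, Finset.mem_coe, Set.mem_ofPred_eq]
  constructor
  · rintro ⟨y, hy, rfl⟩
    simpa using hy
  · intro h
    exact ⟨_, h, by simp⟩

lemma card_image_add (Z : Finset Site) (s : Site) : (Z.image (· + s)).card = Z.card :=
  Finset.card_image_of_injective _ (add_left_injective s)

/-- A translate of a cluster whose lowest site is controlled lies in a bounded box. -/
lemma siteDist_shift_le (ht : t ≠ 0) {Z : Finset Site} {R h : ℕ} {z₀ s : Site}
    (hdiam : ∀ z ∈ Z, siteDist z z₀ ≤ R)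
    (ha : 0 ≤ height (quarterTurn t) (z₀ + s)) (ha' : height (quarterTurn t) (z₀ + s) < height t t)
    (hb : 0 ≤ height t (z₀ + s)) (hb' : height t (z₀ + s) ≤ h) :
    ∀ z ∈ Z.image (· + s), siteDist z 0 ≤ (height t t).toNat + h + R := by
  intro x hx
  obtain ⟨z, hz, rfl⟩ := Finset.mem_image.1 hx
  have h1 := siteDist_zero_le_of_height ht (z₀ + s) (a := (height t t).toNat) (b := h)
    (abs_le.2 (by omega)) (abs_le.2 (by omega))
  have h2 := siteDist_triangle (z + s) (z₀ + s) 0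
  rw [siteDist_add_right] at h2
  have := hdiam z hz
  omega

/-- Checking the sets contained in a large box suffices. -/
theorem nearBelow_of_box (ht : t ≠ 0) (hst : IntStable 𝒰 t)
    (hD : ∀ U ∈ 𝒰, ∀ y ∈ U, siteDist y 0 ≤ D) {k r M : ℕ}
    (hM : 2 * height t t + (r + 2 * D) * height t t + 1 + k * (2 * r + 2 * D) ≤ M)
    (hbox : ∀ Z : Finset Site, Z.card < k → (∀ z ∈ Z, 0 ≤ height t z) →
      (∀ z ∈ Z, siteDist z 0 ≤ M) → ClosureNear 𝒰 t r Z) :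
    NearBelow 𝒰 t k r := by
  have hN := height_self_pos ht
  suffices ∀ j ≤ k, NearBelow 𝒰 t j r from this k le_rfl
  intro j hj
  induction j with
  | zero => exact fun Z hZ => absurd hZ (Nat.not_lt_zero _)
  | succ j ih =>
    refine (ih (by omega)).step hst hD le_rfl fun Z hZ hpos hdiam => ?_
    rcases Z.eq_empty_or_nonempty with rfl | hne
    · rw [Finset.coe_empty]; exact closureNear_empty hst
    obtain ⟨z₀, hz₀, hmin⟩ := Z.exists_min_image (height t) hne
    obtain ⟨i, hi, hi'⟩ := exists_normalize ht z₀
    have hR : ∀ z ∈ Z, siteDist z z₀ ≤ k * (2 * r + 2 * D) := fun z hz =>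
      (hdiam z hz z₀ hz₀).trans (Nat.mul_le_mul_right _ (by omega))
    set N := height t t with hNdef
    set h₀ : ℤ := (r + 2 * D) * N + 1 with hh₀
    have hh₀pos : 0 < h₀ := by positivity
    have hMnat : N.toNat + (N + h₀).toNat + k * (2 * r + 2 * D) ≤ M := by
      zify
      rw [Int.toNat_of_nonneg hN.le, Int.toNat_of_nonneg (by omega)]
      linarith
    have hmain : ∀ s : Site, height (quarterTurn t) s = i * N → height t s ≤ 0 →
        0 ≤ height t (z₀ + s) → height t (z₀ + s) ≤ N + h₀ →
        ClosureNear 𝒰 t r {x | x - s ∈ (Z : Set Site)} := by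
      intro s hs hs' hb hb'
      rw [← coe_image_add]
      have ha : height (quarterTurn t) (z₀ + s) =
          height (quarterTurn t) (z₀ + i • quarterTurn t) := by
        rw [height_add, hs, height_add, height_smul]
        simp only [hNdef, height, quarterTurn]
        ring
      refine hbox _ (by rw [card_image_add]; omega) ?_ ?_
      · intro x hx
        obtain ⟨z, hz, rfl⟩ := Finset.mem_image.1 hx
        have := hmin z hz
        rw [height_add] at hb ⊢
        linarith
      · intro x hx
        exact (siteDist_shift_le ht hR (ha ▸ hi) (ha ▸ hi') hb
          (hb'.trans (Int.self_le_toNat _)) x hx).trans hMnat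
    by_cases hlow : height t z₀ < h₀
    · have hs0 : height t (i • quarterTurn t) = 0 := by
        rw [height_smul, height_quarterTurn, mul_zero]
      refine ClosureNear.of_shift hs0 (hmain _ ?_ hs0.le ?_ ?_)
      · rw [height_smul]; simp only [hNdef, height, quarterTurn]; ring
      · rw [height_add, hs0, add_zero]; exact hpos _ hz₀
      · rw [height_add, hs0]; linarith
    · push Not at hlow
      set j' := (height t z₀ - h₀) / N with hj'
      have h1 := Int.emod_nonneg (height t z₀ - h₀) hN.ne'
      have h2 := Int.emod_lt_of_pos (height t z₀ - h₀) hN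
      have h3 := Int.emod_add_mul_ediv (height t z₀ - h₀) N
      have hj0 : 0 ≤ j' := Int.ediv_nonneg (by linarith) hN.le
      have hs : height t (i • quarterTurn t - j' • t) = - (N * j') := by
        rw [height_sub, height_smul, height_smul, height_quarterTurn, ← hNdef]; ring
      have hsle : height t (i • quarterTurn t - j' • t) ≤ 0 := by
        rw [hs, neg_nonpos]; positivity
      refine ClosureNear.of_lower ht hst hD hsle (hmain _ ?_ hsle ?_ ?_) ?_
      · rw [height_sub, height_smul, height_smul]
        simp only [hNdef, height, quarterTurn]; ring
      · rw [height_add, hs]; linarith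
      · rw [height_add, hs]; linarith
      · intro z hz
        have := hmin z hz
        rw [height_add, hs]
        linarith

lemma exists_uniform {S : Finset (Finset Site)} {Q : Finset Site → ℕ → Prop}
    (hmono : ∀ Z a b, a ≤ b → Q Z a → Q Z b) (h : ∀ Z ∈ S, ∃ b, Q Z b) :
    ∃ b, ∀ Z ∈ S, Q Z b := by
  choose! b hb using h
  exact ⟨S.sup b, fun Z hZ => hmono _ _ _ (Finset.le_sup hZ) (hb Z hZ)⟩

lemma exists_siteNhd_of_finite {W : Set Site} (hW : W.Finite) {z₀ : Site} :
    ∃ b, ∀ w ∈ W, siteDist w z₀ ≤ b :=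
  ⟨hW.toFinset.sup fun w => siteDist w z₀, fun _ hw =>
    Finset.le_sup (f := fun w => siteDist w z₀) (hW.mem_toFinset.2 hw)⟩

lemma mem_powerset_box {Z : Finset Site} {M : ℕ} (h : ∀ z ∈ Z, siteDist z 0 ≤ M) :
    Z ∈ (Finset.Icc (-(M : ℤ)) M ×ˢ Finset.Icc (-(M : ℤ)) M).powerset := by
  rw [Finset.mem_powerset]
  intro z hz
  have := h z hz
  simp only [siteDist, Prod.fst_zero, Prod.snd_zero] at this
  simp only [Finset.mem_product, Finset.mem_Icc]
  omega

/-- If no set of fewer than `k` sites has infinite closure, then closures are uniformly bounded. -/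
theorem exists_nearBelow (ht : t ≠ 0) (hst : IntStable 𝒰 t)
    (hD : ∀ U ∈ 𝒰, ∀ y ∈ U, siteDist y 0 ≤ D)
    (hfree : ∀ Z : Finset Site, (bpClosure 𝒰 (Z : Set Site)).Finite) (k : ℕ)
    (hfin : ∀ Z : Finset Site, Z.card < k → (∀ z ∈ Z, 0 ≤ height t z) →
      (halfClosure 𝒰 t Z \ intHalfPlane t).Finite) : ∃ r, NearBelow 𝒰 t k r := by
  have hN := height_self_pos ht
  induction k with
  | zero => exact ⟨0, fun Z hZ => absurd hZ (Nat.not_lt_zero _)⟩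
  | succ k ih =>
    obtain ⟨r, hr⟩ := ih fun Z hZ => hfin Z (by omega)
    set R := k * (2 * r + 2 * D) with hR
    obtain ⟨b₁, hb₁⟩ := exists_uniform
      (S := (Finset.Icc (-(R : ℤ)) R ×ˢ Finset.Icc (-(R : ℤ)) R).powerset)
      (Q := fun Z b => Z.Nonempty → bpClosure 𝒰 (Z : Set Site) ⊆ siteNhd Z b)
      (fun Z a b hab h hne => (h hne).trans (siteNhd_mono subset_rfl hab)) (fun Z _ => by
        by_cases hne : Z.Nonempty
        · obtain ⟨z₀, hz₀⟩ := hne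
          obtain ⟨b, hb⟩ := exists_siteNhd_of_finite (hfree Z) (z₀ := z₀)
          exact ⟨b, fun _ w hw => ⟨z₀, hz₀, hb w hw⟩⟩
        · exact ⟨0, fun h => absurd h hne⟩)
    set N := height t t with hNdef
    set h₁ : ℤ := (b₁ + 2 * D) * N + 1 with hh₁
    have hh₁pos : 0 < h₁ := by positivity
    set M := N.toNat + h₁.toNat + R with hM
    obtain ⟨b₂, hb₂⟩ := exists_uniform
      (S := (Finset.Icc (-(M : ℤ)) M ×ˢ Finset.Icc (-(M : ℤ)) M).powerset)
      (Q := fun Z b => Z.card < k + 1 → (∀ z ∈ Z, 0 ≤ height t z) → ClosureNear 𝒰 t b Z)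
      (fun Z a b hab h h1 h2 => (h h1 h2).mono hab) (fun Z _ => by
        by_cases hc : Z.card < k + 1 ∧ ∀ z ∈ Z, 0 ≤ height t z
        · rcases Z.eq_empty_or_nonempty with rfl | ⟨z₀, hz₀⟩
          · refine ⟨0, fun _ _ => ?_⟩
            rw [Finset.coe_empty]; exact closureNear_empty hst
          obtain ⟨b, hb⟩ := exists_siteNhd_of_finite (hfin Z hc.1 hc.2) (z₀ := z₀)
          refine ⟨b, fun _ _ w hw => ?_⟩
          by_cases hwH : w ∈ intHalfPlane t
          · exact Or.inl hwH
          · exact Or.inr ⟨z₀, hz₀, hb w ⟨hw, hwH⟩⟩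
        · exact ⟨0, fun h1 h2 => absurd ⟨h1, h2⟩ hc⟩)
    refine ⟨max r (max b₁ b₂), hr.step hst hD (le_max_left _ _) fun Z hZ hpos hdiam => ?_⟩
    rcases Z.eq_empty_or_nonempty with rfl | hne
    · rw [Finset.coe_empty]; exact closureNear_empty hst
    obtain ⟨z₀, hz₀, hmin⟩ := Z.exists_min_image (height t) hne
    have hRz : ∀ z ∈ Z, siteDist z z₀ ≤ R := fun z hz => hdiam z hz z₀ hz₀
    by_cases hlow : height t z₀ < h₁
    · obtain ⟨i, hi, hi'⟩ := exists_normalize ht z₀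
      have hs0 : height t (i • quarterTurn t) = 0 := by
        rw [height_smul, height_quarterTurn, mul_zero]
      refine ClosureNear.mono (r := b₂) (ClosureNear.of_shift hs0 ?_) (by simp)
      rw [← coe_image_add]
      refine hb₂ _ (mem_powerset_box ?_) (by rw [card_image_add]; omega) ?_
      · refine siteDist_shift_le ht hRz hi hi' ?_ ?_
        · rw [height_add, hs0, add_zero]; exact hpos _ hz₀
        · rw [height_add, hs0, add_zero]; omega
      · intro x hx
        obtain ⟨z, hz, rfl⟩ := Finset.mem_image.1 hx
        rw [height_add, hs0, add_zero]
        exact hpos z hz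
    · push Not at hlow
      refine ClosureNear.mono (r := b₁) ?_ (by simp)
      have hnear : bpClosure 𝒰 (Z : Set Site) ⊆ siteNhd Z b₁ := by
        intro w hw
        have h1 := bpClosure_shift (s := -z₀) (B := ((Z.image (· + -z₀) : Finset Site) : Set Site))
          (fun a ha => subset_bpClosure (by simpa using ha)) hw
        obtain ⟨y, hy, hd⟩ := hb₁ _ (mem_powerset_box (fun x hx => by
          obtain ⟨z, hz, rfl⟩ := Finset.mem_image.1 hx
          have := hRz z hz
          rw [← siteDist_add_right _ _ (-z₀)] at this
          simpa using this)) (hne.image _) h1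
        obtain ⟨z, hz, rfl⟩ := Finset.mem_image.1 (Finset.mem_coe.1 hy)
        rw [siteDist_add_right] at hd
        exact ⟨z, hz, hd⟩
      have hcl := bpClosed_union_of_high hst hD (bpClosed_bpClosure (A := (Z : Set Site)))
        (fun w hw => by
          obtain ⟨z, hz, hd⟩ := hnear hw
          have e1 := hmin z hz
          have e2 := abs_le.1 (abs_height_sub_le t _ _ hd)
          linarith)
      exact (halfClosure_subset hcl subset_bpClosure).trans (Set.union_subset_union_right _ hnear)

lemma NearBelow.finite {k r : ℕ} (h : NearBelow 𝒰 t k r) {Z : Finset Site} (hZ : Z.card < k)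
    (hpos : ∀ z ∈ Z, 0 ≤ height t z) : (halfClosure 𝒰 t Z \ intHalfPlane t).Finite := by
  have hsub : halfClosure 𝒰 t Z \ intHalfPlane t ⊆ ⋃ z ∈ Z,
      (Set.Icc (z.1 - (r : ℤ)) (z.1 + r) ×ˢ Set.Icc (z.2 - (r : ℤ)) (z.2 + r)) := by
    intro w hw
    obtain ⟨z, hz, hd⟩ := (h Z hZ hpos hw.1).resolve_left hw.2
    simp only [siteDist] at hd
    refine Set.mem_biUnion hz ?_
    simp only [Set.mem_prod, Set.mem_Icc]
    omega
  exact (Z.finite_toSet.biUnion fun z _ => (Set.finite_Icc _ _).prod (Set.finite_Icc _ _)).subset hsub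

end NearBelow

section Pumping

variable {𝒰 : Finset (Finset Site)} {t : Site} {D : ℕ}

lemma infinite_of_injective_mem {S : Set Site} {x s : Site} (hs : s ≠ 0)
    (h : ∀ n : ℕ, x + n • s ∈ S) : S.Infinite := by
  refine Set.infinite_of_injective_forall_mem (f := fun n : ℕ => x + n • s) (fun a b hab => ?_) h
  have h1 : (a : ℤ) • s = (b : ℤ) • s := by simpa using hab
  exact Nat.cast_injective (smul_left_injective ℤ hs h1)

/-- A finite set which generates a translate of itself generates an infinite set. -/
lemma infinite_of_pump {Z W : Set Site} {s : Site} (hs : s ≠ 0) (hs0 : height t s = 0)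
    (hW : W ⊆ halfClosure 𝒰 t Z) (hWs : ∀ w ∈ W, w + s ∈ halfClosure 𝒰 t W)
    {w : Site} (hw : w ∈ W) (hw0 : 0 ≤ height t w) :
    (halfClosure 𝒰 t Z \ intHalfPlane t).Infinite := by
  have hsn : ∀ n : ℕ, height t (n • s) = 0 := fun n => by
    rw [← natCast_zsmul, height_smul, hs0, mul_zero]
  have key : ∀ n : ℕ, ∀ w ∈ W, w + n • s ∈ halfClosure 𝒰 t Z := by
    intro n
    induction n with
    | zero => intro w hw; simpa using hW hw
    | succ n ih =>
      intro w hw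
      have := halfClosure_shift (hsn n) ih (hWs w hw)
      rwa [add_assoc, ← succ_nsmul'] at this
  refine infinite_of_injective_mem (x := w) hs fun n => ⟨key n w hw, ?_⟩
  simp only [intHalfPlane, Set.mem_ofPred_eq, height_add, hsn]
  omega

lemma abs_height_quarterTurn_le {ε : ℤ} (hε : ε = 1 ∨ ε = -1) {y : Site} (hy : siteDist y 0 ≤ D) :
    |height (ε • quarterTurn t) y| ≤ D * height t t := by
  have := abs_height_le (ε • quarterTurn t) y hy
  convert this using 2
  rcases hε with rfl | rfl <;> simp only [height, quarterTurn, one_smul, neg_smul, Prod.fst_neg,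
    Prod.snd_neg] <;> ring

lemma height_smul_left (ε : ℤ) (t x : Site) : height (ε • t) x = ε * height t x := by
  simp only [height, Prod.smul_fst, Prod.smul_snd, smul_eq_mul]; ring

lemma finite_box (ht : t ≠ 0) {ε : ℤ} (hε : ε = 1 ∨ ε = -1) (a b : ℤ) :
    {x : Site | 0 ≤ height t x ∧ height t x < a ∧ -b < height (ε • quarterTurn t) x ∧
      height (ε • quarterTurn t) x < b}.Finite := by
  refine ((Set.finite_Icc (-(b.toNat + a.toNat : ℤ)) (b.toNat + a.toNat)).prod
    (Set.finite_Icc (-(b.toNat + a.toNat : ℤ)) (b.toNat + a.toNat))).subset ?_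
  rintro x ⟨h1, h2, h3, h4⟩
  rw [height_smul_left] at h3 h4
  have := siteDist_zero_le_of_height ht x (a := b.toNat) (b := a.toNat)
    (abs_le.2 (by rcases hε with rfl | rfl <;> omega)) (abs_le.2 (by omega))
  simp only [siteDist, Prod.fst_zero, Prod.snd_zero] at this
  simp only [Set.mem_prod, Set.mem_Icc]
  omega

lemma exists_unbounded_side (ht : t ≠ 0) {S : Set Site} (hS : S.Infinite) {a : ℤ}
    (h0 : ∀ x ∈ S, 0 ≤ height t x) (ha : ∀ x ∈ S, height t x < a) :
    ∃ ε : ℤ, (ε = 1 ∨ ε = -1) ∧ ∀ B : ℤ, ∃ x ∈ S, B ≤ height (ε • quarterTurn t) x := by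
  by_contra! hcon
  obtain ⟨B₁, h₁⟩ := hcon 1 (Or.inl rfl)
  obtain ⟨B₂, h₂⟩ := hcon (-1) (Or.inr rfl)
  refine hS ((finite_box ht (Or.inl rfl) a (max B₁ B₂)).subset fun x hx => ?_)
  have e1 := h₁ x hx
  have e2 := h₂ x hx
  rw [height_smul_left] at e1 e2
  refine ⟨h0 x hx, ha x hx, ?_, ?_⟩ <;> rw [height_smul_left] <;> omega

/-- An infinite closure contains a finite set which generates a translate of itself. -/
theorem exists_pump (ht : t ≠ 0) (hst : IntStable 𝒰 t)
    (hD : ∀ U ∈ 𝒰, ∀ y ∈ U, siteDist y 0 ≤ D) (Z : Finset Site)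
    (hinf : (halfClosure 𝒰 t Z \ intHalfPlane t).Infinite) :
    ∃ (W : Finset Site) (s : Site), s ≠ 0 ∧ height t s = 0 ∧ W.Nonempty ∧
      (∀ w ∈ W, 0 ≤ height t w) ∧ (W : Set Site) ⊆ halfClosure 𝒰 t Z ∧
      ∀ w ∈ W, w + s ∈ halfClosure 𝒰 t W := by
  have hN := height_self_pos ht
  set N := height t t with hNdef
  obtain ⟨h, hh⟩ : ∃ h : ℕ, ∀ z ∈ Z, height t z < h := by
    refine ⟨(Z.sup fun z => (height t z).toNat) + 1, fun z hz => ?_⟩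
    have := Finset.le_sup (f := fun z => (height t z).toNat) hz
    omega
  have hstrip : ∀ x ∈ halfClosure 𝒰 t Z, height t x < h := by
    intro x hx
    refine bpClosure_subset (bpClosed_intHalfPlane_le hst h) ?_ hx
    rintro y (hy | hy)
    · simp only [intHalfPlane, Set.mem_ofPred_eq] at hy ⊢; omega
    · exact hh y hy
  obtain ⟨ε, hε, hunb⟩ := exists_unbounded_side ht hinf (a := h)
    (fun x hx => not_lt.1 hx.2) (fun x hx => hstrip x hx.1)
  set e := ε • quarterTurn t with he
  have hee : height e e = N := by
    rcases hε with rfl | rfl <;> simp only [he, hNdef, height, quarterTurn, one_smul, neg_smul,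
      Prod.fst_neg, Prod.snd_neg] <;> ring
  have hte : height t e = 0 := by rw [he, height_smul, height_quarterTurn, mul_zero]
  have he0 : e ≠ 0 := by
    intro h0
    rw [h0] at hee
    simp only [height, Prod.fst_zero, mul_zero, Prod.snd_zero, add_zero] at hee
    omega
  obtain ⟨n₀, hn₀⟩ : ∃ n₀ : ℕ, ∀ z ∈ Z, height e z < n₀ * N := by
    refine ⟨(Z.sup fun z => (height e z).toNat) + 1, fun z hz => ?_⟩
    have := Finset.le_sup (f := fun z => (height e z).toNat) hz
    push_cast
    have h1 : height e z < ((Z.sup fun z => (height e z).toNat : ℕ) : ℤ) + 1 := by omega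
    nlinarith
  set P : ℕ → Set Site := fun n => {x | x ∈ halfClosure 𝒰 t Z \ intHalfPlane t ∧
    n * N ≤ height e x ∧ height e x < n * N + D * N} with hP
  have hfar : ∀ n, n₀ ≤ n → ∀ x ∈ halfClosure 𝒰 t Z, n * N ≤ height e x →
      x ∈ halfClosure 𝒰 t (P n) := by
    intro n hn x hx
    obtain ⟨k, hk⟩ := Set.mem_iUnion.1 hx
    clear hx
    have hn' : (n₀ : ℤ) * N ≤ n * N := by gcongr
    induction k generalizing x with
    | zero =>
      intro ha
      rcases hk with hk | hk
      · exact intHalfPlane_subset_halfClosure hk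
      · have := hn₀ x hk
        omega
    | succ k ih =>
      intro ha
      rcases hk with hk | ⟨U, hU, hk'⟩
      · exact ih x hk ha
      have hx : x ∈ halfClosure 𝒰 t Z := Set.mem_iUnion.2 ⟨k + 1, Or.inr ⟨U, hU, hk'⟩⟩
      by_cases hxH : x ∈ intHalfPlane t
      · exact intHalfPlane_subset_halfClosure hxH
      by_cases hxP : height e x < n * N + D * N
      · exact subset_halfClosure ⟨⟨hx, hxH⟩, ha, hxP⟩
      refine bpClosed_bpClosure U hU x fun y hy => ih _ (hk' y hy) ?_
      have := abs_le.1 (abs_height_quarterTurn_le (t := t) hε (hD U hU y hy))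
      rw [height_add]
      linarith
  have hshift : ∀ (n : ℕ) (x : Site), height e (x + n • e) = height e x + n * N := by
    intro n x
    rw [height_add, ← natCast_zsmul, height_smul, hee]
  have hshift' : ∀ (n : ℕ) (x : Site), height t (x + n • e) = height t x := by
    intro n x
    rw [height_add, ← natCast_zsmul, height_smul, hte, mul_zero, add_zero]
  have hfin := (finite_box ht hε h (D * N + 1)).finite_subsets
  rw [← he] at hfin
  have hmaps : ∀ n : ℕ, {x | x + n • e ∈ P n} ⊆ {x : Site | 0 ≤ height t x ∧ height t x < h ∧
      -(D * N + 1 : ℤ) < height e x ∧ height e x < D * N + 1} := by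
    intro n x hx
    simp only [hP, Set.mem_ofPred_eq, Set.mem_sdiff, intHalfPlane] at hx
    obtain ⟨⟨h1, h2⟩, h3, h4⟩ := hx
    have h5 := hstrip _ h1
    have h6 : (0 : ℤ) ≤ D * N := by positivity
    rw [hshift] at h3 h4
    rw [hshift'] at h2 h5
    refine ⟨not_lt.1 h2, h5, ?_, ?_⟩ <;> linarith
  obtain ⟨a, ha, b, hb, hab, heq⟩ := Set.Infinite.exists_ne_map_eq_of_mapsTo
    (s := Set.Ici n₀) (f := fun n : ℕ => {x | x + n • e ∈ P n}) (Set.Ici_infinite n₀)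
    (fun n _ => hmaps n) hfin
  obtain ⟨n, m, hn, hnm, heq⟩ : ∃ n m : ℕ, n₀ ≤ n ∧ n < m ∧
      {x | x + n • e ∈ P n} = {x | x + m • e ∈ P m} := by
    rcases lt_or_gt_of_ne hab with hlt | hlt
    · exact ⟨a, b, ha, hlt, heq⟩
    · exact ⟨b, a, hb, hlt, heq.symm⟩
  have hPfin : (P n).Finite := by
    refine ((hfin.subset (Set.singleton_subset_iff.2 (hmaps n))).sUnion ?_ ).image
      (· + n • e) |>.subset ?_
    · rintro _ rfl
      exact (finite_box ht hε h (D * N + 1)).subset (hmaps n)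
    · intro x hx
      exact ⟨x - n • e, by simpa using hx, by simp⟩
  refine ⟨hPfin.toFinset, (m - n) • e, ?_, ?_, ?_, ?_, ?_, ?_⟩
  · exact smul_ne_zero (by omega) he0
  · rw [← natCast_zsmul, height_smul, hte, mul_zero]
  · rw [Set.Finite.toFinset_nonempty]
    by_contra hempty
    rw [Set.not_nonempty_iff_eq_empty] at hempty
    obtain ⟨x, hx, hxB⟩ := hunb (n * N)
    have := hfar n hn x hx.1 hxB
    rw [hempty, halfClosure_empty hst] at this
    exact hx.2 this
  · intro w hw
    exact not_lt.1 (hPfin.mem_toFinset.1 hw).1.2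
  · intro w hw
    exact (hPfin.mem_toFinset.1 hw).1.1
  · intro w hw
    rw [hPfin.coe_toFinset]
    have hw' : w ∈ P n := hPfin.mem_toFinset.1 hw
    have h1 : w - n • e ∈ {x | x + m • e ∈ P m} := heq ▸ (by simpa using hw')
    have h2 : w + (m - n) • e ∈ P m := by
      have : w + (m - n) • e = w - n • e + m • e := by
        rw [sub_add_eq_add_sub, add_sub_assoc, sub_nsmul _ hnm.le]; rfl
      rw [this]; exact h1
    refine hfar n hn _ h2.1.1 (le_trans ?_ h2.2.1)
    gcongr

/-- If some rule lies in the half-plane and one boundary ray, then a long enough boundary segment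
generates an infinite set. -/
lemma exists_infinite_halfClosure (ht : t ≠ 0) (hD : ∀ U ∈ 𝒰, ∀ y ∈ U, siteDist y 0 ≤ D)
    (hU : ∃ U ∈ 𝒰, ∀ x ∈ U, height t x < 0 ∨
      height t x = 0 ∧ 0 < height (quarterTurn t) x) :
    ∃ Z : Finset Site, (∀ z ∈ Z, 0 ≤ height t z) ∧
      (halfClosure 𝒰 t Z \ intHalfPlane t).Infinite := by
  have hN := height_self_pos ht
  obtain ⟨U, hU, hU'⟩ := hU
  set e := quarterTurn t with he
  set N := height t t with hNdef
  have hee : height e e = N := by simp only [he, hNdef, height, quarterTurn]; ring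
  have hfin : {x : Site | height t x = 0 ∧ 0 < height e x ∧ height e x ≤ D * N}.Finite := by
    refine (finite_box ht (Or.inl rfl) 1 (D * N + 1)).subset ?_
    rintro x ⟨h1, h2, h3⟩
    have : (0 : ℤ) ≤ D * N := by positivity
    rw [one_smul]
    refine ⟨h1.ge, by omega, ?_, ?_⟩ <;> linarith
  refine ⟨hfin.toFinset, fun z hz => (hfin.mem_toFinset.1 hz).1.ge, ?_⟩
  rw [hfin.coe_toFinset]
  set Z := {x : Site | height t x = 0 ∧ 0 < height e x ∧ height e x ≤ D * N}
  have key : ∀ (n : ℕ) (x : Site), height t x = 0 → height e x ≤ D * N →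
      D * N - n < height e x → x ∈ halfClosure 𝒰 t Z := by
    intro n
    induction n with
    | zero => intro x _ h1 h2; simp only [Nat.cast_zero, sub_zero] at h2; omega
    | succ n ih =>
      intro x h0 h1 h2
      by_cases hpos : 0 < height e x
      · exact subset_halfClosure ⟨h0, hpos, h1⟩
      refine bpClosed_bpClosure U hU x fun y hy => ?_
      have h3 := abs_le.1 (abs_height_quarterTurn_le (t := t) (Or.inl rfl) (hD U hU y hy))
      rw [one_smul] at h3
      rcases hU' y hy with h | ⟨h, h'⟩
      · exact intHalfPlane_subset_halfClosure (by
          simp only [intHalfPlane, Set.mem_ofPred_eq, height_add]; omega)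
      · push_cast at h2
        refine ih _ (by rw [height_add]; omega) ?_ ?_ <;> rw [height_add] <;> linarith
  have he0 : -e ≠ 0 := by
    intro h0
    rw [neg_eq_zero] at h0
    rw [h0] at hee
    simp only [height, Prod.fst_zero, mul_zero, Prod.snd_zero, add_zero] at hee
    omega
  refine infinite_of_injective_mem (x := 0) he0 fun n => ?_
  have h1 : height t (0 + n • -e) = 0 := by
    rw [zero_add, ← natCast_zsmul, height_smul, height_neg, he, height_quarterTurn]; ring
  have h2 : height e (0 + n • -e) = - (n * N) := by
    rw [zero_add, ← natCast_zsmul, height_smul, height_neg, hee]; ring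
  have h3 : (0 : ℤ) ≤ D * N := by positivity
  have h4 : (0 : ℤ) ≤ n * N := by positivity
  refine ⟨key (D * N + n * N + 1).toNat _ h1 ?_ ?_, ?_⟩
  · rw [h2]; linarith
  · rw [Int.toNat_of_nonneg (by linarith), h2]; linarith
  · simp only [intHalfPlane, Set.mem_ofPred_eq, h1]; omega

end Pumping

/-- The update family encoded by a list of lists. -/
def family (L : List (List Site)) : Finset (Finset Site) := (L.map List.toFinset).toFinset

lemma toFinset_mem_family {L : List (List Site)} {U : List Site} (hU : U ∈ L) :
    U.toFinset ∈ family L := List.mem_toFinset.2 (List.mem_map.2 ⟨U, hU, rfl⟩)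

lemma exists_family {L : List (List Site)} {P : Finset Site → Prop} :
    (∃ U ∈ family L, P U) ↔ ∃ U ∈ L, P U.toFinset := by simp [family]

lemma forall_family {L : List (List Site)} {P : Finset Site → Prop} :
    (∀ U ∈ family L, P U) ↔ ∀ U ∈ L, P U.toFinset := by simp [family]

/-- `ℓ` lists sites with times, each derivable from the half-plane, `Z` and earlier listed sites. -/
def Derives (L : List (List Site)) (t : Site) (Z : List Site) (ℓ : List (Site × ℕ)) : Prop :=
  ∀ p ∈ ℓ, p.1 ∈ Z ∨ ∃ U ∈ L, ∀ y ∈ U,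
    height t (p.1 + y) < 0 ∨ ∃ q ∈ ℓ, q.1 = p.1 + y ∧ q.2 < p.2

/-- A certificate that adding some `k` sites to the half-plane has an infinite effect. -/
def GrowthCert (L : List (List Site)) (t : Site) (k : ℕ)
    (c : (List Site × List Site × Site) × (List (Site × ℕ) × List (Site × ℕ))) : Prop :=
  c.1.1.length ≤ k ∧ (∀ z ∈ c.1.1, 0 ≤ height t z) ∧
  Derives L t c.1.1 c.2.1 ∧ Derives L t c.1.2.1 c.2.2 ∧
  (∃ w ∈ c.1.2.1, 0 ≤ height t w) ∧
  (∀ w ∈ c.1.2.1, (∃ p ∈ c.2.1, p.1 = w) ∧ ∃ p ∈ c.2.2, p.1 = w + c.1.2.2) ∧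
  height t c.1.2.2 = 0 ∧ c.1.2.2 ≠ 0

lemma Derives.mem {L : List (List Site)} {t : Site} {Z : List Site} {ℓ : List (Site × ℕ)}
    (h : Derives L t Z ℓ) {p : Site × ℕ} (hp : p ∈ ℓ) :
    p.1 ∈ halfClosure (family L) t {z | z ∈ Z} := by
  induction hn : p.2 using Nat.strong_induction_on generalizing p with
  | _ n ih =>
    rcases h p hp with h | ⟨U, hU, h⟩
    · exact subset_halfClosure h
    · refine bpClosed_bpClosure U.toFinset (toFinset_mem_family hU) _ fun y hy => ?_
      rcases h y (List.mem_toFinset.1 hy) with h | ⟨q, hq, he, hlt⟩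
      · exact intHalfPlane_subset_halfClosure h
      · rw [← he]; exact ih q.2 (hn ▸ hlt) hq rfl

lemma GrowthCert.exists_infinite {L : List (List Site)} {t : Site} {k : ℕ} {c}
    (h : GrowthCert L t k c) : ∃ Z : Finset Site, Z.card ≤ k ∧ (∀ z ∈ Z, 0 ≤ height t z) ∧
      (halfClosure (family L) t Z \ intHalfPlane t).Infinite := by
  obtain ⟨⟨Z, W, s⟩, ℓ₁, ℓ₂⟩ := c
  obtain ⟨h1, h2, h3, h4, ⟨w, hw, hw0⟩, h6, h7, h8⟩ := h
  refine ⟨Z.toFinset, (List.toFinset_card_le Z).trans h1, by simpa using h2, ?_⟩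
  rw [List.coe_toFinset]
  refine infinite_of_pump (W := {w | w ∈ W}) h8 h7 (fun w hw => ?_) (fun w hw => ?_) hw hw0
  · obtain ⟨p, hp, rfl⟩ := (h6 w hw).1
    exact h3.mem hp
  · obtain ⟨p, hp, he⟩ := (h6 w hw).2
    exact he ▸ h4.mem hp

lemma finite_bpIter_diff {𝒰 : Finset (Finset Site)} {t : Site} (hst : IntStable 𝒰 t)
    {Z : Set Site} (hZ : Z.Finite) (n : ℕ) :
    (bpIter 𝒰 (intHalfPlane t ∪ Z) n \ intHalfPlane t).Finite := by
  induction n with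
  | zero =>
    refine hZ.subset fun x hx => hx.1.resolve_left hx.2
  | succ n ih =>
    refine (ih.union (𝒰.finite_toSet.biUnion fun U _ => U.finite_toSet.biUnion fun y _ =>
      ih.image (· - y))).subset ?_
    rintro x ⟨hx | ⟨U, hU, hx⟩, hxH⟩
    · exact Or.inl ⟨hx, hxH⟩
    · right
      have : ∃ y ∈ U, x + y ∉ intHalfPlane t := by
        by_contra! hcon
        exact hxH (bpClosed_intHalfPlane hst U hU x hcon)
      obtain ⟨y, hy, hn⟩ := this
      exact Set.mem_biUnion hU (Set.mem_biUnion hy ⟨x + y, ⟨hx y hy, hn⟩, by simp⟩)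

lemma exists_derives {L : List (List Site)} {t : Site} (hst : IntStable (family L) t)
    (Z : List Site) (n : ℕ) : ∃ ℓ, Derives L t Z ℓ ∧ (∀ p ∈ ℓ, p.2 ≤ n) ∧
      ∀ x ∈ bpIter (family L) (intHalfPlane t ∪ {z | z ∈ Z}) n, x ∉ intHalfPlane t →
        ∃ p ∈ ℓ, p.1 = x := by
  induction n with
  | zero =>
    refine ⟨Z.map (·, 0), ?_, ?_, ?_⟩
    · intro p hp
      obtain ⟨z, hz, rfl⟩ := List.mem_map.1 hp
      exact Or.inl hz
    · intro p hp
      obtain ⟨z, hz, rfl⟩ := List.mem_map.1 hp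
      exact le_rfl
    · intro x hx hxH
      exact ⟨(x, 0), List.mem_map.2 ⟨x, hx.resolve_left hxH, rfl⟩, rfl⟩
  | succ n ih =>
    obtain ⟨ℓ, h1, h2, h3⟩ := ih
    have hfin := finite_bpIter_diff hst (List.finite_toSet Z) (n + 1)
    refine ⟨ℓ ++ hfin.toFinset.toList.map (·, n + 1), ?_, ?_, ?_⟩
    · have hold : ∀ p ∈ ℓ, p.1 ∈ Z ∨ ∃ U ∈ L, ∀ y ∈ U, height t (p.1 + y) < 0 ∨
          ∃ q ∈ ℓ ++ hfin.toFinset.toList.map (·, n + 1), q.1 = p.1 + y ∧ q.2 < p.2 := by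
        intro p hp
        refine (h1 p hp).imp_right ?_
        rintro ⟨U, hU, h⟩
        refine ⟨U, hU, fun y hy => (h y hy).imp_right ?_⟩
        rintro ⟨q, hq, h⟩
        exact ⟨q, List.mem_append_left _ hq, h⟩
      intro p hp
      rcases List.mem_append.1 hp with hp | hp
      · exact hold p hp
      obtain ⟨x, hx, rfl⟩ := List.mem_map.1 hp
      obtain ⟨hx, hxH⟩ := hfin.mem_toFinset.1 (Finset.mem_toList.1 hx)
      rcases hx with hx | hx
      · obtain ⟨p, hpℓ, rfl⟩ := h3 x hx hxH
        refine (hold p hpℓ).imp_right ?_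
        rintro ⟨U, hU, h⟩
        refine ⟨U, hU, fun y hy => (h y hy).imp_right ?_⟩
        rintro ⟨q, hq, h, h'⟩
        exact ⟨q, hq, h, h'.trans (Nat.lt_succ_of_le (h2 p hpℓ))⟩
      · obtain ⟨U, hU, hx⟩ := exists_family.1 hx
        refine Or.inr ⟨U, hU, fun y hy => ?_⟩
        by_cases hy0 : x + y ∈ intHalfPlane t
        · exact Or.inl hy0
        · obtain ⟨p, hp, he⟩ := h3 _ (hx y (List.mem_toFinset.2 hy)) hy0
          exact Or.inr ⟨p, List.mem_append_left _ hp, he, Nat.lt_succ_of_le (h2 p hp)⟩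
    · intro p hp
      rcases List.mem_append.1 hp with hp | hp
      · exact (h2 p hp).trans (Nat.le_succ n)
      · obtain ⟨x, hx, rfl⟩ := List.mem_map.1 hp
        exact le_rfl
    · intro x hx hxH
      refine ⟨(x, n + 1), List.mem_append_right _ (List.mem_map.2 ⟨x, ?_, rfl⟩), rfl⟩
      exact Finset.mem_toList.2 (hfin.mem_toFinset.2 ⟨hx, hxH⟩)

lemma exists_derives_of_subset {L : List (List Site)} {t : Site} (hst : IntStable (family L) t)
    {Z S : Finset Site} (hS : (S : Set Site) ⊆ halfClosure (family L) t Z)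
    (hSt : ∀ x ∈ S, 0 ≤ height t x) :
    ∃ ℓ, Derives L t Z.toList ℓ ∧ ∀ x ∈ S, ∃ p ∈ ℓ, p.1 = x := by
  have h : ∀ x : S, ∃ n, x.1 ∈ bpIter (family L) (intHalfPlane t ∪ {z | z ∈ Z.toList}) n :=
    fun x => Set.mem_iUnion.1 (by
      have := hS x.2
      rw [halfClosure, bpClosure] at this
      simpa using this)
  choose n hn using h
  obtain ⟨ℓ, h1, -, h3⟩ := exists_derives hst Z.toList (Finset.univ.sup n)
  refine ⟨ℓ, h1, fun x hx => h3 x ?_ (not_lt.2 (hSt x hx))⟩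
  exact bpIter_mono_time (Finset.le_sup (Finset.mem_univ ⟨x, hx⟩)) (hn ⟨x, hx⟩)

lemma siteDist_bound (𝒰 : Finset (Finset Site)) :
    ∃ D, ∀ U ∈ 𝒰, ∀ y ∈ U, siteDist y 0 ≤ D :=
  ⟨𝒰.sup fun U => U.sup fun y => siteDist y 0, fun _ hU _ hy =>
    (Finset.le_sup (f := fun y => siteDist y 0) hy).trans
      (Finset.le_sup (f := fun U : Finset Site => U.sup fun y => siteDist y 0) hU)⟩

lemma exists_growthCert {L : List (List Site)} {t : Site} (ht : t ≠ 0)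
    (hst : IntStable (family L) t) {k : ℕ} {Z : Finset Site} (hk : Z.card ≤ k)
    (hpos : ∀ z ∈ Z, 0 ≤ height t z)
    (hinf : (halfClosure (family L) t Z \ intHalfPlane t).Infinite) :
    ∃ c, GrowthCert L t k c := by
  obtain ⟨D, hD⟩ := siteDist_bound (family L)
  obtain ⟨W, s, hs, hs0, ⟨w, hw⟩, hWpos, hWZ, hWs⟩ := exists_pump ht hst hD Z hinf
  obtain ⟨ℓ₁, h₁, h₁'⟩ := exists_derives_of_subset hst hWZ hWpos
  obtain ⟨ℓ₂, h₂, h₂'⟩ := exists_derives_of_subset hst (Z := W) (S := W.image (· + s))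
    (by intro x hx
        obtain ⟨w, hw, rfl⟩ := Finset.mem_image.1 (Finset.mem_coe.1 hx)
        exact hWs w hw)
    (by intro x hx
        obtain ⟨w, hw, rfl⟩ := Finset.mem_image.1 hx
        rw [height_add, hs0, add_zero]
        exact hWpos w hw)
  refine ⟨((Z.toList, W.toList, s), ℓ₁, ℓ₂), by simpa using hk, by simpa using hpos, h₁, h₂,
    ⟨w, by simpa using hw, hWpos w hw⟩, fun w hw => ?_, hs0, hs⟩
  have hw' : w ∈ W := by simpa using hw
  exact ⟨h₁' w hw', h₂' _ (Finset.mem_image_of_mem _ hw')⟩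

/-- A certificate that adding fewer than `k` sites to the half-plane has a finite effect. -/
def BoundCert (L : List (List Site)) (t : Site) (k : ℕ)
    (c : (ℕ × ℕ × ℕ) × (List Site × List (List Site × List Site))) : Prop :=
  (∀ U ∈ L, ∀ y ∈ U, siteDist y 0 ≤ c.1.1) ∧
  2 * height t t + (c.1.2.1 + 2 * c.1.1) * height t t + 1 + k * (2 * c.1.2.1 + 2 * c.1.1)
    ≤ c.1.2.2 ∧
  (∀ i < 2 * c.1.2.2 + 1, ∀ j < 2 * c.1.2.2 + 1,
    height t ((i : ℤ) - c.1.2.2, (j : ℤ) - c.1.2.2) < 0 ∨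
      ((i : ℤ) - c.1.2.2, (j : ℤ) - c.1.2.2) ∈ c.2.1) ∧
  (0 < k → ∃ q ∈ c.2.2, q.1 = []) ∧
  (∀ q ∈ c.2.2, q.1.length + 1 < k → ∀ z ∈ c.2.1, ∃ q' ∈ c.2.2, q'.1 = z :: q.1) ∧
  ∀ q ∈ c.2.2, (∀ z ∈ q.1, z ∈ q.2) ∧ (∀ w ∈ q.2, ∃ z ∈ q.1, siteDist w z ≤ c.1.2.1) ∧
    ∀ U ∈ L, ∀ y ∈ U, ∀ w ∈ q.2, height t (w - y) < 0 ∨ w - y ∈ q.2 ∨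
      ∃ y' ∈ U, 0 ≤ height t (w - y + y') ∧ w - y + y' ∉ q.2

lemma BoundCert.finite {L : List (List Site)} {t : Site} (ht : t ≠ 0)
    (hst : IntStable (family L) t) {k : ℕ} {c} (h : BoundCert L t k c) {Z : Finset Site}
    (hZ : Z.card < k) (hpos : ∀ z ∈ Z, 0 ≤ height t z) :
    (halfClosure (family L) t Z \ intHalfPlane t).Finite := by
  obtain ⟨⟨D, r, M⟩, b, F⟩ := c
  obtain ⟨h1, h2, h3, h4, h5, h6⟩ := h
  dsimp only at h1 h2 h3 h4 h5 h6
  have hD : ∀ U ∈ family L, ∀ y ∈ U, siteDist y 0 ≤ D := forall_family.2 (by simpa using h1)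
  refine (nearBelow_of_box ht hst hD h2 fun Z hZ hpos hbox => ?_ : NearBelow _ t k r).finite hZ hpos
  have hb : ∀ z ∈ Z, z ∈ b := by
    intro z hz
    have e1 := hbox z hz
    simp only [siteDist, Prod.fst_zero, Prod.snd_zero] at e1
    have e2 := h3 (z.1 + M).toNat (by omega) (z.2 + M).toNat (by omega)
    rw [Int.toNat_of_nonneg (by omega), Int.toNat_of_nonneg (by omega), add_sub_cancel_right,
      add_sub_cancel_right] at e2
    exact e2.resolve_left (not_lt.2 (hpos z hz))
  have hlist : ∀ l : List Site, l.length < k → (∀ z ∈ l, z ∈ b) → ∃ q ∈ F, q.1 = l := by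
    intro l
    induction l with
    | nil => exact fun hl _ => h4 hl
    | cons z l ih =>
      intro hl hzl
      rw [List.length_cons] at hl
      obtain ⟨q, hq, rfl⟩ := ih (by omega) fun z hz => hzl z (List.mem_cons_of_mem _ hz)
      exact h5 q hq hl z (hzl z List.mem_cons_self)
  obtain ⟨q, hq, he⟩ := hlist Z.toList (by simpa using hZ) (by simpa using hb)
  obtain ⟨k1, k2, k3⟩ := h6 q hq
  rw [he] at k1 k2
  have hcl : BpClosed (family L) (intHalfPlane t ∪ {w | w ∈ q.2}) := by
    intro U hU x hx
    by_cases hxH : x ∈ intHalfPlane t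
    · exact Or.inl hxH
    have : ∃ y ∈ U, x + y ∉ intHalfPlane t := by
      by_contra! hcon
      exact hxH (bpClosed_intHalfPlane hst U hU x hcon)
    obtain ⟨y, hy, hn⟩ := this
    obtain ⟨U, hUL, rfl⟩ : ∃ U' ∈ L, U'.toFinset = U := by simpa [family] using hU
    have := k3 U hUL y (List.mem_toFinset.1 hy) _ ((hx y hy).resolve_left hn)
    rw [add_sub_cancel_right] at this
    rcases this with h | h | ⟨y', hy', h, h'⟩
    · exact Or.inl h
    · exact Or.inr h
    · exact absurd ((hx y' (List.mem_toFinset.2 hy')).resolve_left (not_lt.2 h)) h'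
  refine (halfClosure_subset hcl fun z hz => k1 z (by simpa using hz)).trans
    (Set.union_subset_union_right _ ?_)
  intro w hw
  obtain ⟨z, hz, hd⟩ := k2 w hw
  exact ⟨z, by simpa using hz, hd⟩

lemma exists_lists (b : List Site) (k : ℕ) :
    ∃ F : List (List Site), ∀ l, l ∈ F ↔ l.length < k ∧ ∀ z ∈ l, z ∈ b := by
  induction k with
  | zero => exact ⟨[], fun l => by simp⟩
  | succ k ih =>
    obtain ⟨F, hF⟩ := ih
    refine ⟨[] :: F.flatMap fun l => b.map (· :: l), fun l => ?_⟩
    cases l with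
    | nil => simp
    | cons z l =>
      simp only [List.mem_cons, reduceCtorEq, List.mem_flatMap, List.mem_map, List.cons.injEq,
        false_or, List.length_cons, add_lt_add_iff_right, hF, forall_eq_or_imp]
      constructor
      · rintro ⟨l, h, z, hz, rfl, rfl⟩
        exact ⟨h.1, hz, h.2⟩
      · rintro ⟨h1, hz, h2⟩
        exact ⟨l, ⟨h1, h2⟩, z, hz, rfl, rfl⟩

lemma exists_boundCert {L : List (List Site)} {t : Site} (ht : t ≠ 0)
    (hst : IntStable (family L) t)
    (hfree : ∀ Z : Finset Site, (bpClosure (family L) (Z : Set Site)).Finite) {k : ℕ}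
    (hfin : ∀ Z : Finset Site, Z.card < k → (∀ z ∈ Z, 0 ≤ height t z) →
      (halfClosure (family L) t Z \ intHalfPlane t).Finite) : ∃ c, BoundCert L t k c := by
  obtain ⟨D, hD⟩ := siteDist_bound (family L)
  obtain ⟨r, hr⟩ := exists_nearBelow ht hst hD hfree k hfin
  obtain ⟨M, hM⟩ : ∃ M : ℕ, 2 * height t t + (r + 2 * D) * height t t + 1 +
      k * (2 * r + 2 * D) ≤ M := ⟨_, Int.self_le_toNat _⟩
  set b := ((Finset.Icc (-(M : ℤ)) M ×ˢ Finset.Icc (-(M : ℤ)) M).filter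
    fun z : Site => 0 ≤ height t z).toList with hb
  have hbpos : ∀ z ∈ b, 0 ≤ height t z := fun z hz => by
    rw [hb, Finset.mem_toList, Finset.mem_filter] at hz
    exact hz.2
  obtain ⟨F, hF⟩ := exists_lists b k
  have hWfin : ∀ l ∈ F, (halfClosure (family L) t {z | z ∈ l} \ intHalfPlane t).Finite := by
    intro l hl
    have := hfin l.toFinset ((List.toFinset_card_le l).trans_lt ((hF l).1 hl).1)
      (fun z hz => hbpos z (((hF l).1 hl).2 z (List.mem_toFinset.1 hz)))
    rwa [List.coe_toFinset] at this
  set W : List Site → List Site := fun l =>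
    if h : (halfClosure (family L) t {z | z ∈ l} \ intHalfPlane t).Finite then
      h.toFinset.toList else [] with hW
  have hmem : ∀ l ∈ F, ∀ w, w ∈ W l ↔
      w ∈ halfClosure (family L) t {z | z ∈ l} \ intHalfPlane t := by
    intro l hl w
    simp only [hW, dif_pos (hWfin l hl), Finset.mem_toList, Set.Finite.mem_toFinset]
  refine ⟨((D, r, M), b, F.map fun l => (l, W l)), ?_, hM, ?_, ?_, ?_, ?_⟩
  · simpa using forall_family.1 hD
  · intro i hi j hj
    rw [or_iff_not_imp_left]
    intro hneg
    rw [hb, Finset.mem_toList, Finset.mem_filter, Finset.mem_product, Finset.mem_Icc,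
      Finset.mem_Icc]
    dsimp only at hi hj ⊢
    refine ⟨by omega, not_lt.1 hneg⟩
  · intro hk
    exact ⟨([], W []), List.mem_map.2 ⟨[], (hF _).2 ⟨by simpa using hk, by simp⟩, rfl⟩, rfl⟩
  · intro q hq hlen z hz
    obtain ⟨l, hl, rfl⟩ := List.mem_map.1 hq
    refine ⟨(z :: l, W (z :: l)), List.mem_map.2 ⟨z :: l, (hF _).2 ⟨by simpa using hlen, ?_⟩, rfl⟩,
      rfl⟩
    intro x hx
    rcases List.mem_cons.1 hx with rfl | hx
    · exact hz
    · exact ((hF l).1 hl).2 x hx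
  · intro q hq
    obtain ⟨l, hl, rfl⟩ := List.mem_map.1 hq
    have hl' := (hF l).1 hl
    refine ⟨fun z hz => (hmem l hl z).2 ⟨subset_halfClosure hz, not_lt.2 (hbpos z (hl'.2 z hz))⟩,
      ?_, ?_⟩
    · intro w hw
      have hw' := (hmem l hl w).1 hw
      have := hr l.toFinset ((List.toFinset_card_le l).trans_lt hl'.1)
        (fun z hz => hbpos z (hl'.2 z (List.mem_toFinset.1 hz)))
      rw [List.coe_toFinset] at this
      obtain ⟨z, hz, hd⟩ := (this hw'.1).resolve_left hw'.2
      exact ⟨z, hz, hd⟩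
    · intro U hU y hy w hw
      by_contra! hcon
      obtain ⟨c1, c2, c3⟩ := hcon
      dsimp only at c2 c3
      refine c2 ((hmem l hl _).2 ⟨?_, not_lt.2 c1⟩)
      refine bpClosed_bpClosure U.toFinset (toFinset_mem_family hU) _ fun y' hy' => ?_
      by_cases h0 : 0 ≤ height t (w - y + y')
      · exact ((hmem l hl _).1 (c3 y' (List.mem_toFinset.1 hy') h0)).1
      · exact intHalfPlane_subset_halfClosure (not_le.1 h0)

section Primrec

variable {α : Type} [Primcodable α]

@[fun_prop] lemma primrec_height {f g : α → Site} (hf : Primrec f) (hg : Primrec g) :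
    Primrec fun a => height (f a) (g a) := by unfold height; fun_prop

@[fun_prop] lemma primrec_quarterTurn {f : α → Site} (hf : Primrec f) :
    Primrec fun a => quarterTurn (f a) := by unfold quarterTurn; fun_prop

@[fun_prop] lemma primrec_site_add {f g : α → Site} (hf : Primrec f) (hg : Primrec g) :
    Primrec fun a => f a + g a := by
  have : Primrec fun a => ((f a).1 + (g a).1, (f a).2 + (g a).2) := by fun_prop
  exact this

@[fun_prop] lemma primrec_site_sub {f g : α → Site} (hf : Primrec f) (hg : Primrec g) :
    Primrec fun a => f a - g a := by
  have : Primrec fun a => ((f a).1 - (g a).1, (f a).2 - (g a).2) := by fun_prop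
  exact this

@[fun_prop] lemma primrec_site_neg {f : α → Site} (hf : Primrec f) :
    Primrec fun a => - f a := by
  have : Primrec fun a => (- (f a).1, - (f a).2) := by fun_prop
  exact this

@[fun_prop] lemma primrec_siteDist {f g : α → Site} (hf : Primrec f) (hg : Primrec g) :
    Primrec fun a => siteDist (f a) (g a) := by
  have hmax : ∀ {u v : α → ℕ}, Primrec u → Primrec v → Primrec fun a => max (u a) (v a) :=
    fun hu hv => Primrec.nat_max.comp hu hv
  have habs : ∀ {u : α → ℤ}, Primrec u → Primrec fun a => (u a).natAbs := fun hu =>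
    (hmax (Primrec.int_toNat.comp hu) (Primrec.int_toNat.comp (Primrec.fp_int_neg hu))).of_eq
      fun a => by omega
  exact hmax (habs (by fun_prop)) (habs (by fun_prop))

end Primrec

lemma primrecPred_derives : PrimrecPred fun q : (List (List Site) × Site) ×
    (List Site × List (Site × ℕ)) => Derives q.1.1 q.1.2 q.2.1 q.2.2 := by
  unfold Derives
  repeat' first
    | fun_prop
    | refine PrimrecPred.all_mem ?_ ?_
    | refine PrimrecPred.ex_mem ?_ ?_
    | refine PrimrecPred.mem_list ?_ ?_
    | refine PrimrecPred.or ?_ ?_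
    | refine PrimrecPred.and ?_ ?_
    | refine PrimrecPred.int_lt ?_ ?_
    | refine PrimrecPred.nat_lt' ?_ ?_
    | refine PrimrecPred.eq' ?_ ?_

lemma primrecPred_growthCert : PrimrecPred fun q : ((List (List Site) × Site) × ℕ) ×
    ((List Site × List Site × Site) × (List (Site × ℕ) × List (Site × ℕ))) =>
      GrowthCert q.1.1.1 q.1.1.2 q.1.2 q.2 := by
  unfold GrowthCert
  repeat' first
    | fun_prop
    | exact primrecPred_derives.comp (f := fun q : ((List (List Site) × Site) × ℕ) ×
        ((List Site × List Site × Site) × (List (Site × ℕ) × List (Site × ℕ))) =>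
          (q.1.1, (q.2.1.1, q.2.2.1))) (by fun_prop)
    | exact primrecPred_derives.comp (f := fun q : ((List (List Site) × Site) × ℕ) ×
        ((List Site × List Site × Site) × (List (Site × ℕ) × List (Site × ℕ))) =>
          (q.1.1, (q.2.1.2.1, q.2.2.2))) (by fun_prop)
    | refine PrimrecPred.all_mem ?_ ?_
    | refine PrimrecPred.ex_mem ?_ ?_
    | refine PrimrecPred.and ?_ ?_
    | refine PrimrecPred.int_le ?_ ?_
    | refine PrimrecPred.nat_le' ?_ ?_
    | refine PrimrecPred.eq' ?_ ?_
    | refine PrimrecPred.ne' ?_ ?_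

lemma primrecPred_boundCert {α : Type} [Primcodable α] {L : α → List (List Site)} {t : α → Site}
    {k D r M : α → ℕ} {b : α → List Site} {F : α → List (List Site × List Site)}
    (hL : Primrec L) (ht : Primrec t) (hk : Primrec k) (hD : Primrec D) (hr : Primrec r)
    (hM : Primrec M) (hb : Primrec b) (hF : Primrec F) :
    PrimrecPred fun a => BoundCert (L a) (t a) (k a) ((D a, r a, M a), (b a, F a)) := by
  unfold BoundCert
  dsimp only
  repeat' first
    | fun_prop
    | refine PrimrecPred.all_mem ?_ ?_
    | refine PrimrecPred.all_lt ?_ ?_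
    | refine PrimrecPred.ex_mem ?_ ?_
    | refine PrimrecPred.and ?_ ?_
    | refine PrimrecPred.or ?_ ?_
    | refine PrimrecPred.not (PrimrecPred.mem_list ?_ ?_)
    | refine PrimrecPred.mem_list ?_ ?_
    | refine PrimrecPred.int_lt ?_ ?_
    | refine PrimrecPred.nat_lt' ?_ ?_
    | refine PrimrecPred.int_le ?_ ?_
    | refine PrimrecPred.nat_le' ?_ ?_
    | refine PrimrecPred.eq' ?_ ?_
    | refine PrimrecPred.imp ?_ ?_

/-- The Euclidean inner product. -/
def dot2 (u v : ℝ × ℝ) : ℝ := u.1 * v.1 + u.2 * v.2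

/-- The determinant of a pair of vectors. -/
def cross2 (u v : ℝ × ℝ) : ℝ := u.1 * v.2 - u.2 * v.1

/-- A lattice site as a real vector. -/
def realSite (x : Site) : ℝ × ℝ := (x.1, x.2)

lemma inner2_realSite (t x : Site) : inner2 x (realSite t) = (height t x : ℝ) := by
  simp [inner2, realSite, height]

lemma cross2_realSite (t x : Site) :
    cross2 (realSite t) (realSite x) = (height (quarterTurn t) x : ℝ) := by
  simp [cross2, realSite, height, quarterTurn]; ring

lemma dot2_realSite (t x : Site) : dot2 (realSite t) (realSite x) = (height x t : ℝ) := by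
  simp [dot2, realSite, height]

lemma halfPlane_realSite (t : Site) : halfPlane (realSite t) = intHalfPlane t := by
  ext x
  simp only [halfPlane, intHalfPlane, Set.mem_ofPred_eq, inner2_realSite]
  exact_mod_cast Iff.rfl

lemma inner2_smul (x : Site) (c : ℝ) (u : ℝ × ℝ) : inner2 x (c • u) = c * inner2 x u := by
  simp only [inner2, Prod.smul_fst, Prod.smul_snd, smul_eq_mul]; ring

lemma inner2_add_left (x y : Site) (u : ℝ × ℝ) : inner2 (x + y) u = inner2 x u + inner2 y u := by
  simp only [inner2, Prod.fst_add, Prod.snd_add, Int.cast_add]; ring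

lemma halfPlane_smul {c : ℝ} (hc : 0 < c) (u : ℝ × ℝ) : halfPlane (c • u) = halfPlane u := by
  ext x
  simp only [halfPlane, Set.mem_ofPred_eq, inner2_smul]
  exact ⟨fun h => by by_contra hn; nlinarith, fun h => mul_neg_of_pos_of_neg hc h⟩

lemma dot2_self_pos {u : ℝ × ℝ} (hu : u ≠ 0) : 0 < dot2 u u := by
  have : u.1 ≠ 0 ∨ u.2 ≠ 0 := by
    by_contra! h
    exact hu (Prod.ext h.1 h.2)
  simp only [dot2]
  rcases this with h | h <;> have := mul_self_pos.2 h <;>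
    nlinarith [mul_self_nonneg u.1, mul_self_nonneg u.2]

lemma not_unstable_iff {𝒰 : Finset (Finset Site)} {u : ℝ × ℝ} :
    ¬ Unstable 𝒰 u ↔ ∀ U ∈ 𝒰, ∃ x ∈ U, 0 ≤ inner2 x u := by
  simp only [Unstable, halfPlane, Set.subset_def, Finset.mem_coe, Set.mem_ofPred_eq]
  push Not
  rfl

/-- Some rule lies in the union of the half-plane and one of its two boundary rays. -/
def SideUnstable (𝒰 : Finset (Finset Site)) (σ : ℝ) (u : ℝ × ℝ) : Prop :=
  ∃ U ∈ 𝒰, ∀ x ∈ U, inner2 x u < 0 ∨ inner2 x u = 0 ∧ 0 < σ * cross2 u (realSite x)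

/-- There are rules for both boundary rays. -/
def TwoSided (𝒰 : Finset (Finset Site)) (u : ℝ × ℝ) : Prop :=
  SideUnstable 𝒰 1 u ∧ SideUnstable 𝒰 (-1) u

/-- Stable directions that are not two-sided. -/
def Degenerate (𝒰 : Finset (Finset Site)) (u : ℝ × ℝ) : Prop :=
  ¬ Unstable 𝒰 u ∧ ¬ TwoSided 𝒰 u

lemma TwoSided.smul {𝒰 : Finset (Finset Site)} {u : ℝ × ℝ} (h : TwoSided 𝒰 u) {c : ℝ}
    (hc : 0 < c) : TwoSided 𝒰 (c • u) := by
  have key : ∀ σ, SideUnstable 𝒰 σ u → SideUnstable 𝒰 σ (c • u) := by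
    rintro σ ⟨U, hU, h⟩
    refine ⟨U, hU, fun x hx => ?_⟩
    have : σ * cross2 (c • u) (realSite x) = c * (σ * cross2 u (realSite x)) := by
      simp only [cross2, Prod.smul_fst, Prod.smul_snd, smul_eq_mul]; ring
    rw [inner2_smul, this]
    rcases h x hx with h | ⟨h, h'⟩
    · exact Or.inl (mul_neg_of_pos_of_neg hc h)
    · exact Or.inr ⟨by rw [h, mul_zero], mul_pos hc h'⟩
  exact ⟨key 1 h.1, key (-1) h.2⟩

/-- A scale invariant set of directions between the degenerate and the stable ones. -/
structure IsBadSet (𝒰 : Finset (Finset Site)) (B : ℝ × ℝ → Prop) : Prop where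
  of_degenerate : ∀ u, Degenerate 𝒰 u → B u
  not_unstable : ∀ u, B u → ¬ Unstable 𝒰 u
  smul : ∀ (c : ℝ) (u), 0 < c → B u → B (c • u)

lemma degenerate_of_pos {𝒰 : Finset (Finset Site)} {w₀ w : ℝ × ℝ} (hw : w ≠ 0)
    (h : ∀ U ∈ 𝒰, ∃ x ∈ U, 0 < inner2 x w₀ ∧ 0 ≤ inner2 x w) : Degenerate 𝒰 w := by
  have key : ∀ x : Site, inner2 x w = 0 →
      inner2 x w₀ * dot2 w w = cross2 w (realSite x) * cross2 w w₀ := by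
    intro x hx
    have h1 : (x.1 : ℝ) * w.1 + x.2 * w.2 = 0 := hx
    simp only [inner2, dot2, cross2, realSite]
    linear_combination (w.1 * w₀.1 + w.2 * w₀.2) * h1
  have hpos := dot2_self_pos hw
  refine ⟨not_unstable_iff.2 fun U hU => ?_, ?_⟩
  · obtain ⟨x, hx, -, h⟩ := h U hU
    exact ⟨x, hx, h⟩
  rintro ⟨⟨U₁, hU₁, h₁⟩, ⟨U₂, hU₂, h₂⟩⟩
  rcases le_total 0 (cross2 w w₀) with hd | hd
  · obtain ⟨x, hx, hx0, hx1⟩ := h U₂ hU₂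
    obtain ⟨e1, e2⟩ := (h₂ x hx).resolve_left (not_lt.2 hx1)
    have := key x e1
    nlinarith [mul_pos hx0 hpos]
  · obtain ⟨x, hx, hx0, hx1⟩ := h U₁ hU₁
    obtain ⟨e1, e2⟩ := (h₁ x hx).resolve_left (not_lt.2 hx1)
    have := key x e1
    nlinarith [mul_pos hx0 hpos]

/-- Walking from a strictly stable direction, one meets a degenerate direction. -/
lemma exists_degenerate {𝒰 : Finset (Finset Site)} {w₀ w₁ v : ℝ × ℝ}
    (h₀ : 0 < dot2 w₀ v) (h₁ : 0 < dot2 w₁ v)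
    (hst : ∀ U ∈ 𝒰, ∃ x ∈ U, 0 < inner2 x w₀) :
    Degenerate 𝒰 w₁ ∨ ∃ a b : ℝ, 0 < a ∧ 0 < b ∧ Degenerate 𝒰 (a • w₀ + b • w₁) ∧
      ∃ U ∈ 𝒰, ∃ x ∈ U, inner2 x (a • w₀ + b • w₁) = 0 := by
  have hne : ∀ w, 0 < dot2 w v → w ≠ 0 := by
    rintro w hw rfl
    simp [dot2] at hw
  by_cases hall : ∀ U ∈ 𝒰, ∀ x ∈ U, 0 < inner2 x w₀ → 0 ≤ inner2 x w₁
  · refine Or.inl (degenerate_of_pos (w₀ := w₀) (hne _ h₁) fun U hU => ?_)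
    obtain ⟨x, hx, h⟩ := hst U hU
    exact ⟨x, hx, h, hall U hU x hx h⟩
  right
  push Not at hall
  obtain ⟨U₀, hU₀, x₀, hx₀, hx₀'⟩ := hall
  have hmem : ∀ {x}, x ∈ (𝒰.biUnion id).filter (fun x => 0 < inner2 x w₀ ∧ inner2 x w₁ < 0) ↔
      (∃ U ∈ 𝒰, x ∈ U) ∧ 0 < inner2 x w₀ ∧ inner2 x w₁ < 0 := by
    intro x
    simp
  obtain ⟨y, hy, hmin⟩ := Finset.exists_min_image
    ((𝒰.biUnion id).filter fun x => 0 < inner2 x w₀ ∧ inner2 x w₁ < 0)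
    (fun x => inner2 x w₀ / (- inner2 x w₁)) ⟨x₀, hmem.2 ⟨⟨U₀, hU₀, hx₀⟩, hx₀'⟩⟩
  obtain ⟨⟨U, hU, hyU⟩, hy0, hy1⟩ := hmem.1 hy
  have hcomb : ∀ x : Site, inner2 x ((- inner2 y w₁) • w₀ + inner2 y w₀ • w₁) =
      - inner2 y w₁ * inner2 x w₀ + inner2 y w₀ * inner2 x w₁ := by
    intro x
    simp only [inner2, Prod.fst_add, Prod.snd_add, Prod.smul_fst, Prod.smul_snd, smul_eq_mul]
    ring
  refine ⟨- inner2 y w₁, inner2 y w₀, by linarith, hy0, ?_, U, hU, y, hyU, by rw [hcomb]; ring⟩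
  refine degenerate_of_pos (w₀ := w₀) (hne _ ?_) fun U hU => ?_
  · have : dot2 ((- inner2 y w₁) • w₀ + inner2 y w₀ • w₁) v =
        - inner2 y w₁ * dot2 w₀ v + inner2 y w₀ * dot2 w₁ v := by
      simp only [dot2, Prod.fst_add, Prod.snd_add, Prod.smul_fst, Prod.smul_snd, smul_eq_mul]
      ring
    rw [this]
    nlinarith [mul_pos hy0 h₁, mul_pos (neg_pos.2 hy1) h₀]
  · obtain ⟨x, hx, h⟩ := hst U hU
    refine ⟨x, hx, h, ?_⟩
    rw [hcomb]
    rcases le_or_gt 0 (inner2 x w₁) with hx1 | hx1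
    · nlinarith [mul_nonneg hy0.le hx1, mul_pos (neg_pos.2 hy1) h]
    · have := hmin x (hmem.2 ⟨⟨U, hU, hx⟩, h, hx1⟩)
      rw [div_le_div_iff₀ (neg_pos.2 hy1) (neg_pos.2 hx1)] at this
      linarith

/-- The candidate centres of semicircles. -/
def IsCandidate (𝒰 : Finset (Finset Site)) (v : Site) : Prop :=
  ∃ U ∈ 𝒰, ∃ x ∈ U, v = x ∨ v = -x

/-- The directions to be tested in the semicircle of centre `v`. -/
def IsTest (𝒰 : Finset (Finset Site)) (v t : Site) : Prop :=
  (t = v ∨ ∃ x, IsCandidate 𝒰 x ∧ t = quarterTurn x) ∧ 0 < height v t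

lemma realSite_ne_zero {x : Site} (hx : x ≠ 0) : realSite x ≠ 0 := by
  intro h
  refine hx (Prod.ext ?_ ?_)
  · have := congrArg Prod.fst h
    simpa [realSite] using this
  · have := congrArg Prod.snd h
    simpa [realSite] using this

/-- A vector orthogonal to `x` is a multiple of a quarter turn of `x` or `-x`. -/
lemma exists_smul_quarterTurn {x : Site} (hx : x ≠ 0) {u : ℝ × ℝ} (hu : u ≠ 0)
    (h : inner2 x u = 0) : ∃ c : ℝ, 0 < c ∧
      (c • u = realSite (quarterTurn x) ∨ c • u = realSite (quarterTurn (-x))) := by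
  have h1 : (x.1 : ℝ) * u.1 + x.2 * u.2 = 0 := h
  have hpos := dot2_self_pos hu
  obtain ⟨d, hd⟩ : ∃ d, d = cross2 u (realSite x) := ⟨_, rfl⟩
  have e1 : dot2 u u * x.2 = d * u.1 := by
    simp only [hd, dot2, cross2, realSite]
    linear_combination u.2 * h1
  have e2 : dot2 u u * x.1 = - d * u.2 := by
    simp only [hd, dot2, cross2, realSite]
    linear_combination u.1 * h1
  have e1' : (x.2 : ℝ) = d / dot2 u u * u.1 := by field_simp; linarith
  have e2' : (x.1 : ℝ) = - d / dot2 u u * u.2 := by field_simp; linarith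
  rcases lt_trichotomy d 0 with h0 | h0 | h0
  · refine ⟨- d / dot2 u u, div_pos (by linarith) hpos, Or.inl (Prod.ext ?_ ?_)⟩
    · simp [realSite, quarterTurn, e1']; ring
    · simp [realSite, quarterTurn, e2']
  · refine absurd (Prod.ext ?_ ?_) hx
    · simpa [h0] using e2'
    · simpa [h0] using e1'
  · refine ⟨d / dot2 u u, div_pos h0 hpos, Or.inr (Prod.ext ?_ ?_)⟩
    · simp [realSite, quarterTurn, e1']
    · simp [realSite, quarterTurn, e2']; ring

lemma ne_zero_of_dot2_pos {w v : ℝ × ℝ} (h : 0 < dot2 w v) : w ≠ 0 := by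
  rintro rfl
  simp [dot2] at h

lemma dot2_smul_left (c : ℝ) (w v : ℝ × ℝ) : dot2 (c • w) v = c * dot2 w v := by
  simp only [dot2, Prod.smul_fst, Prod.smul_snd, smul_eq_mul]; ring

lemma dot2_add_left (u w v : ℝ × ℝ) : dot2 (u + w) v = dot2 u v + dot2 w v := by
  simp only [dot2, Prod.fst_add, Prod.snd_add]; ring

lemma strictly_stable {𝒰 : Finset (Finset Site)} {w : ℝ × ℝ} (hw : ¬ Unstable 𝒰 w)
    (h : ∀ U ∈ 𝒰, ∀ x ∈ U, inner2 x w ≠ 0) : ∀ U ∈ 𝒰, ∃ x ∈ U, 0 < inner2 x w := by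
  intro U hU
  obtain ⟨x, hx, hx'⟩ := not_unstable_iff.1 hw U hU
  exact ⟨x, hx, hx'.lt_of_ne (h U hU x hx).symm⟩

section BadSet

variable {𝒰 : Finset (Finset Site)} {B : ℝ × ℝ → Prop}

lemma IsBadSet.exists_isTest (hB : IsBadSet 𝒰 B) {v : Site} {w : ℝ × ℝ} (hw : B w)
    (hv : 0 < dot2 w (realSite v)) {U : Finset Site} (hU : U ∈ 𝒰) {x : Site} (hx : x ∈ U)
    (hx0 : x ≠ 0) (hxw : inner2 x w = 0) : ∃ t, IsTest 𝒰 v t ∧ B (realSite t) := by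
  obtain ⟨c, hc, h⟩ := exists_smul_quarterTurn hx0 (ne_zero_of_dot2_pos hv) hxw
  have key : ∀ y, IsCandidate 𝒰 y → c • w = realSite (quarterTurn y) →
      ∃ t, IsTest 𝒰 v t ∧ B (realSite t) := by
    intro y hy e
    refine ⟨quarterTurn y, ⟨Or.inr ⟨y, hy, rfl⟩, ?_⟩, e ▸ hB.smul c w hc hw⟩
    have : 0 < dot2 (realSite (quarterTurn y)) (realSite v) := by
      rw [← e, dot2_smul_left]
      exact mul_pos hc hv
    rw [dot2_realSite] at this
    exact_mod_cast this
  rcases h with h | h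
  · exact key x ⟨U, hU, x, hx, Or.inl rfl⟩ h
  · exact key (-x) ⟨U, hU, x, hx, Or.inr rfl⟩ h

/-- A semicircle around a candidate centre is tested by finitely many directions. -/
lemma IsBadSet.forall_not_of_isTest (hB : IsBadSet 𝒰 B) (hX : ∀ U ∈ 𝒰, ∀ x ∈ U, x ≠ 0)
    {v : Site} (hv : IsCandidate 𝒰 v) (h : ∀ t, IsTest 𝒰 v t → ¬ B (realSite t))
    {w : ℝ × ℝ} (hw : 0 < dot2 w (realSite v)) : ¬ B w := by
  intro hBw
  have hv0 : v ≠ 0 := by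
    obtain ⟨U, hU, x, hx, e⟩ := hv
    have := hX U hU x hx
    rcases e with rfl | rfl
    · exact this
    · exact neg_ne_zero.2 this
  have hvv := dot2_self_pos (realSite_ne_zero hv0)
  by_cases hp : ∃ U ∈ 𝒰, ∃ x ∈ U, inner2 x w = 0
  · obtain ⟨U, hU, x, hx, hxw⟩ := hp
    obtain ⟨t, ht, hBt⟩ := hB.exists_isTest hBw hw hU hx (hX U hU x hx) hxw
    exact h t ht hBt
  push Not at hp
  rcases exists_degenerate hw hvv (strictly_stable (hB.not_unstable w hBw) hp) with
    hd | ⟨a, b, ha, hb, hd, U, hU, x, hx, hxw⟩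
  · refine h v ⟨Or.inl rfl, ?_⟩ (hB.of_degenerate _ hd)
    rw [dot2_realSite] at hvv
    exact_mod_cast hvv
  · obtain ⟨t, ht, hBt⟩ := hB.exists_isTest (v := v) (hB.of_degenerate _ hd) (by
      rw [dot2_add_left, dot2_smul_left, dot2_smul_left]
      positivity) hU hx (hX U hU x hx) hxw
    exact h t ht hBt

/-- If a semicircle avoids a bad set then so does one whose centre is a candidate. -/
lemma IsBadSet.exists_isCandidate (hB : IsBadSet 𝒰 B) (hX : ∀ U ∈ 𝒰, ∀ x ∈ U, x ≠ 0)
    (hne : ∃ U ∈ 𝒰, ∃ x : Site, x ∈ U) {v : ℝ × ℝ} (hv : v ≠ 0)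
    (h : ∀ w, 0 < dot2 w v → ¬ B w) :
    ∃ y, IsCandidate 𝒰 y ∧ ∀ w, 0 < dot2 w (realSite y) → ¬ B w := by
  have hvv := dot2_self_pos hv
  by_cases hpar : ∃ U ∈ 𝒰, ∃ x ∈ U, cross2 v (realSite x) = 0
  · obtain ⟨U, hU, x, hx, hxv⟩ := hpar
    have hxx := dot2_self_pos (realSite_ne_zero (hX U hU x hx))
    have e : ∀ w, dot2 w v * dot2 v (realSite x) = dot2 w (realSite x) * dot2 v v := by
      intro w
      simp only [cross2, dot2] at hxv ⊢
      linear_combination (w.1 * v.2 - w.2 * v.1) * hxv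
    have e2 := e (realSite x)
    rcases lt_trichotomy (dot2 v (realSite x)) 0 with h0 | h0 | h0
    · refine ⟨-x, ⟨U, hU, x, hx, Or.inr rfl⟩, fun w hw => h w ?_⟩
      have : dot2 w (realSite (-x)) = - dot2 w (realSite x) := by
        simp [dot2, realSite]; ring
      rw [this] at hw
      nlinarith [e w, mul_pos hw hvv]
    · rw [h0, mul_zero] at e2
      exact absurd e2 (mul_pos hxx hvv).ne
    · refine ⟨x, ⟨U, hU, x, hx, Or.inl rfl⟩, fun w hw => h w ?_⟩
      nlinarith [e w, mul_pos hw hvv]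
  push Not at hpar
  have hcr_neg : ∀ x : Site, cross2 v (realSite (-x)) = - cross2 v (realSite x) := by
    intro x
    simp [cross2, realSite]; ring
  have hin_neg : ∀ (x : Site) (u), inner2 (-x) u = - inner2 x u := by
    intro x u
    simp [inner2]; ring
  obtain ⟨V, hV, hmem⟩ : ∃ V : Finset Site, V.Nonempty ∧
      ∀ y, y ∈ V ↔ IsCandidate 𝒰 y ∧ 0 < cross2 v (realSite y) := by
    have hs : ∀ y, y ∈ ((𝒰.biUnion id) ∪ (𝒰.biUnion id).image (fun x => -x)).filter
        (fun y => 0 < cross2 v (realSite y)) ↔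
        IsCandidate 𝒰 y ∧ 0 < cross2 v (realSite y) := by
      intro y
      simp only [Finset.mem_filter, Finset.mem_union, Finset.mem_biUnion, id, Finset.mem_image,
        IsCandidate]
      constructor
      · rintro ⟨⟨U, hU, hy⟩ | ⟨x, ⟨U, hU, hx⟩, e⟩, h⟩
        · exact ⟨⟨U, hU, y, hy, Or.inl rfl⟩, h⟩
        · exact ⟨⟨U, hU, x, hx, Or.inr e.symm⟩, h⟩
      · rintro ⟨⟨U, hU, x, hx, e | e⟩, h⟩
        · exact ⟨Or.inl ⟨U, hU, e ▸ hx⟩, h⟩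
        · exact ⟨Or.inr ⟨x, ⟨U, hU, hx⟩, e.symm⟩, h⟩
    refine ⟨_, ?_, hs⟩
    obtain ⟨U, hU, x, hx⟩ := hne
    rcases (hpar U hU x hx).lt_or_gt with h0 | h0
    · exact ⟨-x, (hs _).2 ⟨⟨U, hU, x, hx, Or.inr rfl⟩, by rw [hcr_neg]; linarith⟩⟩
    · exact ⟨x, (hs _).2 ⟨⟨U, hU, x, hx, Or.inl rfl⟩, h0⟩⟩
  obtain ⟨y, hy, hmax⟩ := Finset.exists_max_image V
    (fun y => dot2 v (realSite y) / cross2 v (realSite y)) hV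
  obtain ⟨hyc, hyv⟩ := (hmem y).1 hy
  have hperp : ∀ u, 0 < dot2 u (realSite y) → dot2 u v ≤ 0 →
      ∀ U ∈ 𝒰, ∀ x ∈ U, inner2 x u ≠ 0 := by
    intro u huy huv
    have key : ∀ x, IsCandidate 𝒰 x → 0 < cross2 v (realSite x) → inner2 x u ≠ 0 := by
      intro x hx hxv hxu
      have hm := hmax x ((hmem x).2 ⟨hx, hxv⟩)
      rw [div_le_div_iff₀ hxv hyv] at hm
      have i1 : inner2 x u * cross2 v (realSite y) =
          cross2 (realSite x) (realSite y) * dot2 u v +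
            cross2 v (realSite x) * dot2 u (realSite y) := by
        simp only [inner2, cross2, dot2, realSite]; ring
      have i2 : dot2 v (realSite x) * cross2 v (realSite y) =
          cross2 (realSite x) (realSite y) * dot2 v v +
            cross2 v (realSite x) * dot2 v (realSite y) := by
        simp only [cross2, dot2, realSite]; ring
      have i3 : cross2 (realSite x) (realSite y) ≤ 0 := by
        by_contra hc
        nlinarith [mul_pos (not_le.1 hc) hvv]
      rw [hxu, zero_mul] at i1
      nlinarith [mul_pos hxv huy, mul_nonneg_of_nonpos_of_nonpos i3 huv]
    intro U hU x hx hxu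
    rcases (hpar U hU x hx).lt_or_gt with h0 | h0
    · exact key (-x) ⟨U, hU, x, hx, Or.inr rfl⟩ (by rw [hcr_neg]; linarith)
        (by rw [hin_neg, hxu, neg_zero])
    · exact key x ⟨U, hU, x, hx, Or.inl rfl⟩ h0 hxu
  refine ⟨y, hyc, fun w hw hBw => ?_⟩
  have hwv : dot2 w v ≤ 0 := not_lt.1 fun hn => h w hn hBw
  obtain ⟨w₁, hw₁v, hw₁y⟩ : ∃ w₁ : ℝ × ℝ, 0 < dot2 w₁ v ∧ 0 < dot2 w₁ (realSite y) := by
    refine ⟨((realSite y).2 - v.2, v.1 - (realSite y).1), ?_, ?_⟩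
    · refine lt_of_lt_of_eq hyv ?_
      simp only [cross2, dot2]; ring
    · refine lt_of_lt_of_eq hyv ?_
      simp only [cross2, dot2]; ring
  rcases exists_degenerate hw hw₁y
    (strictly_stable (hB.not_unstable w hBw) (hperp w hw hwv)) with
    hd | ⟨a, b, ha, hb, hd, U, hU, x, hx, hxw⟩
  · exact h _ hw₁v (hB.of_degenerate _ hd)
  · have hpos : 0 < dot2 (a • w + b • w₁) (realSite y) := by
      rw [dot2_add_left, dot2_smul_left, dot2_smul_left]
      positivity
    refine hperp _ hpos (not_lt.1 fun hn => h _ hn (hB.of_degenerate _ hd)) U hU x hx hxw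

/-- Reducing a statement about all semicircles to finitely many lattice directions. -/
lemma IsBadSet.exists_semicircle_iff (hB : IsBadSet 𝒰 B) (hU : IsUpdateFamily 𝒰) :
    (∃ v ∈ sphere2, ∀ u ∈ openSemicircle v, ¬ B u) ↔
      ∃ v, IsCandidate 𝒰 v ∧ ∀ t, IsTest 𝒰 v t → ¬ B (realSite t) := by
  have hX : ∀ U ∈ 𝒰, ∀ x ∈ U, x ≠ 0 := by
    rintro U hU' x hx rfl
    exact (hU.2 U hU').2 hx
  have hnorm : ∀ w : ℝ × ℝ, w ≠ 0 → ∃ c : ℝ, 0 < c ∧ c • w ∈ sphere2 := by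
    intro w hw
    have h0 := dot2_self_pos hw
    refine ⟨(√(dot2 w w))⁻¹, inv_pos.2 (Real.sqrt_pos.2 h0), ?_⟩
    have h1 := Real.sq_sqrt h0.le
    have h2 := (Real.sqrt_pos.2 h0).ne'
    simp only [sphere2, Set.mem_ofPred_eq, Prod.smul_fst, Prod.smul_snd, smul_eq_mul]
    field_simp
    rw [h1]
    simp only [dot2]; ring
  constructor
  · rintro ⟨v, hv, h⟩
    obtain ⟨U, hU'⟩ := hU.1
    obtain ⟨x, hx⟩ := (hU.2 U hU').1
    have hv0 : v ≠ 0 := by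
      rintro rfl
      simp [sphere2] at hv
    obtain ⟨y, hy, h'⟩ := hB.exists_isCandidate hX ⟨U, hU', x, hx⟩ hv0 fun w hw hBw => by
      obtain ⟨c, hc, hcw⟩ := hnorm w (ne_zero_of_dot2_pos hw)
      refine h (c • w) ⟨hcw, ?_⟩ (hB.smul c w hc hBw)
      have := mul_pos hc hw
      rwa [← dot2_smul_left] at this
    refine ⟨y, hy, fun t ht => h' _ ?_⟩
    rw [dot2_realSite]
    exact_mod_cast ht.2
  · rintro ⟨v, hv, h⟩
    have hv0 : v ≠ 0 := by
      obtain ⟨U, hU', x, hx, e⟩ := hv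
      have := hX U hU' x hx
      rcases e with rfl | rfl
      · exact this
      · exact neg_ne_zero.2 this
    obtain ⟨c, hc, hcv⟩ := hnorm _ (realSite_ne_zero hv0)
    refine ⟨_, hcv, fun u hu => hB.forall_not_of_isTest hX hv h ?_⟩
    have h2 : 0 < dot2 u (c • realSite v) := hu.2
    have e : dot2 u (c • realSite v) = c * dot2 u (realSite v) := by
      simp only [dot2, Prod.smul_fst, Prod.smul_snd, smul_eq_mul]; ring
    rw [e] at h2
    exact pos_of_mul_pos_right h2 hc.le

end BadSet

section Directions

open Filter Topology

lemma abs_le_one_of_mem_sphere2 {u : ℝ × ℝ} (hu : u ∈ sphere2) : |u.1| ≤ 1 ∧ |u.2| ≤ 1 := by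
  have h : u.1 ^ 2 + u.2 ^ 2 = 1 := hu
  constructor <;> refine abs_le_one_iff_mul_self_le_one.2 ?_ <;> nlinarith [sq_nonneg u.1, sq_nonneg u.2]

lemma isCompact_sphere2 : IsCompact sphere2 := by
  refine (isCompact_Icc (a := ((-1, -1) : ℝ × ℝ)) (b := (1, 1))).of_isClosed_subset
    (isClosed_eq (by fun_prop) continuous_const) fun u hu => ?_
  have := abs_le_one_of_mem_sphere2 hu
  exact ⟨⟨(abs_le.1 this.1).1, (abs_le.1 this.2).1⟩, (abs_le.1 this.1).2, (abs_le.1 this.2).2⟩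

lemma exists_uniform_stable {𝒰 : Finset (Finset Site)} (h : ¬ Supercritical 𝒰) :
    ∃ δ : ℝ, 0 < δ ∧ ∀ v ∈ sphere2, ∃ u ∈ sphere2, ¬ Unstable 𝒰 u ∧ δ ≤ dot2 u v := by
  refine isCompact_sphere2.induction_on
    (p := fun s => ∃ δ : ℝ, 0 < δ ∧ ∀ v ∈ s, ∃ u ∈ sphere2, ¬ Unstable 𝒰 u ∧ δ ≤ dot2 u v)
    ⟨1, one_pos, by simp⟩ ?_ ?_ ?_
  · rintro s t hst ⟨δ, hδ, h⟩
    exact ⟨δ, hδ, fun v hv => h v (hst hv)⟩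
  · rintro s t ⟨δ, hδ, h⟩ ⟨δ', hδ', h'⟩
    refine ⟨min δ δ', lt_min hδ hδ', ?_⟩
    rintro v (hv | hv)
    · obtain ⟨u, hu, hu', e⟩ := h v hv
      exact ⟨u, hu, hu', (min_le_left _ _).trans e⟩
    · obtain ⟨u, hu, hu', e⟩ := h' v hv
      exact ⟨u, hu, hu', (min_le_right _ _).trans e⟩
  · intro v hv
    simp only [Supercritical] at h
    push Not at h
    obtain ⟨u, ⟨hu, huv⟩, hst⟩ := h v hv
    have hcont : Continuous fun v' : ℝ × ℝ => dot2 u v' := by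
      unfold dot2; fun_prop
    change 0 < dot2 u v at huv
    refine ⟨{v' | dot2 u v / 2 < dot2 u v'}, mem_nhdsWithin_of_mem_nhds
      ((isOpen_lt continuous_const hcont).mem_nhds (half_lt_self huv)), _, half_pos huv,
      fun v' hv' => ⟨u, hu, hst, le_of_lt hv'⟩⟩

/-- Finite sets have finite closures unless the family is supercritical. -/
lemma finite_bpClosure {𝒰 : Finset (Finset Site)} (h : ¬ Supercritical 𝒰) (Z : Finset Site) :
    (bpClosure 𝒰 Z).Finite := by
  obtain ⟨δ, hδ, h⟩ := exists_uniform_stable h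
  obtain ⟨C, hC⟩ : ∃ C : ℝ, ∀ z ∈ Z, ∀ u ∈ sphere2, inner2 z u ≤ C := by
    refine ⟨∑ z ∈ Z, (|(z.1 : ℝ)| + |(z.2 : ℝ)|), fun z hz u hu => ?_⟩
    refine le_trans ?_ (Finset.single_le_sum (f := fun z : Site => |(z.1 : ℝ)| + |(z.2 : ℝ)|)
      (fun z _ => by positivity) hz)
    obtain ⟨h1, h2⟩ := abs_le_one_of_mem_sphere2 hu
    refine add_le_add ((le_abs_self _).trans ?_) ((le_abs_self _).trans ?_) <;> rw [abs_mul]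
    · exact mul_le_of_le_one_right (abs_nonneg _) h1
    · exact mul_le_of_le_one_right (abs_nonneg _) h2
  set S : Set Site := {x | ∀ u ∈ sphere2, ¬ Unstable 𝒰 u → inner2 x u ≤ C} with hS
  have hcl : BpClosed 𝒰 S := by
    intro U hU x hx u hu hst
    obtain ⟨y, hy, hy0⟩ := not_unstable_iff.1 hst U hU
    have := hx y hy u hu hst
    rw [inner2_add_left] at this
    linarith
  refine Set.Finite.subset ?_ (bpClosure_subset hcl fun z hz u hu _ => hC z hz u hu)
  have hbound : ∀ x ∈ S, x ≠ 0 → √(dot2 (realSite x) (realSite x)) ≤ C / δ := by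
    intro x hx hx0
    have h0 := dot2_self_pos (realSite_ne_zero hx0)
    have h2 := Real.sqrt_pos.2 h0
    obtain ⟨u, hu, hst, e⟩ := h ((√(dot2 (realSite x) (realSite x)))⁻¹ • realSite x) (by
      simp only [sphere2, Set.mem_ofPred_eq, Prod.smul_fst, Prod.smul_snd, smul_eq_mul]
      field_simp
      rw [Real.sq_sqrt h0.le]
      simp only [dot2]; ring)
    have h3 := hx u hu hst
    have e2 : dot2 u ((√(dot2 (realSite x) (realSite x)))⁻¹ • realSite x) =
        inner2 x u / √(dot2 (realSite x) (realSite x)) := by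
      simp only [dot2, inner2, realSite, Prod.smul_fst, Prod.smul_snd, smul_eq_mul]
      field_simp
    rw [e2, le_div_iff₀ h2] at e
    rw [le_div_iff₀ hδ]
    linarith
  obtain ⟨N, hN⟩ := exists_nat_ge (C / δ)
  refine (Set.finite_Icc ((-N, -N) : Site) (N, N)).subset fun x hx => ?_
  by_cases hx0 : x = 0
  · rw [hx0]
    exact ⟨⟨by simp, by simp⟩, by simp, by simp⟩
  have hb := (hbound x hx hx0).trans hN
  have key : ∀ a : ℤ, (a : ℝ) ^ 2 ≤ dot2 (realSite x) (realSite x) → |a| ≤ N := by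
    intro a ha
    have : |(a : ℝ)| ≤ N := (Real.abs_le_sqrt ha).trans hb
    exact_mod_cast this
  have k1 := abs_le.1 (key x.1 (by simp only [dot2, realSite]; nlinarith [sq_nonneg (x.2 : ℝ)]))
  have k2 := abs_le.1 (key x.2 (by simp only [dot2, realSite]; nlinarith [sq_nonneg (x.1 : ℝ)]))
  exact ⟨⟨k1.1, k2.1⟩, k1.2, k2.2⟩

lemma continuous_inner2 (x : Site) : Continuous fun u : ℝ × ℝ => inner2 x u := by
  unfold inner2; fun_prop

lemma ne_zero_of_mem_sphere2 {u : ℝ × ℝ} (hu : u ∈ sphere2) : u ≠ 0 := by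
  rintro rfl
  simp [sphere2] at hu

lemma eq_of_cross2_eq_zero {u w : ℝ × ℝ} (hu : u ∈ sphere2) (hw : w ∈ sphere2)
    (h : cross2 u w = 0) (h' : 0 < dot2 u w) : w = u := by
  have h1 : u.1 ^ 2 + u.2 ^ 2 = 1 := hu
  have h2 : w.1 ^ 2 + w.2 ^ 2 = 1 := hw
  simp only [cross2] at h
  have h3 : dot2 u w = 1 := by
    have : dot2 u w ^ 2 = 1 := by
      simp only [dot2]
      linear_combination (w.1 ^ 2 + w.2 ^ 2) * h1 + h2 - (u.1 * w.2 - u.2 * w.1) * h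
    nlinarith
  simp only [dot2] at h3
  have h4 : (w.1 - u.1) ^ 2 + (w.2 - u.2) ^ 2 = 0 := by linear_combination h1 + h2 - 2 * h3
  refine Prod.ext ?_ ?_ <;> nlinarith [sq_nonneg (w.1 - u.1), sq_nonneg (w.2 - u.2)]

lemma SideUnstable.eventually_unstable {𝒰 : Finset (Finset Site)} {σ : ℝ} {u : ℝ × ℝ} (hu : u ≠ 0)
    (h : SideUnstable 𝒰 σ u) : ∀ᶠ w in 𝓝 u, σ * cross2 u w < 0 → Unstable 𝒰 w := by
  obtain ⟨U, hU, h⟩ := h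
  have hev : ∀ᶠ w in 𝓝 u, ∀ x ∈ U, inner2 x u < 0 → inner2 x w < 0 := by
    refine (Filter.eventually_all_finset U).2 fun x _ => ?_
    by_cases hx : inner2 x u < 0
    · filter_upwards [(isOpen_lt (continuous_inner2 x) continuous_const).mem_nhds hx] with w hw _
      exact hw
    · exact Eventually.of_forall fun w hx' => absurd hx' hx
  have hpos := dot2_self_pos hu
  filter_upwards [hev] with w hw hσ
  refine ⟨U, hU, fun x hx => ?_⟩
  rcases h x hx with h0 | ⟨h0, h1⟩
  · exact hw x hx h0
  · have key : inner2 x w * dot2 u u = cross2 u (realSite x) * cross2 u w := by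
      have h1 : (x.1 : ℝ) * u.1 + x.2 * u.2 = 0 := h0
      simp only [inner2, dot2, cross2, realSite]
      linear_combination (u.1 * w.1 + u.2 * w.2) * h1
    have : 0 < σ ^ 2 := by
      rcases eq_or_ne σ 0 with rfl | hσ0
      · simp at hσ
      · positivity
    have h2 : σ ^ 2 * (inner2 x w * dot2 u u) < 0 := by
      rw [key]
      nlinarith [mul_neg_of_pos_of_neg h1 hσ]
    change inner2 x w < 0
    by_contra hn
    have := mul_nonneg this.le (mul_nonneg (not_lt.1 hn) hpos.le)
    linarith

lemma TwoSided.isolatedStable {𝒰 : Finset (Finset Site)} {u : ℝ × ℝ} (hu : u ∈ sphere2)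
    (hst : ¬ Unstable 𝒰 u) (h : TwoSided 𝒰 u) : IsolatedStable 𝒰 u := by
  refine ⟨⟨hu, hst⟩, ?_⟩
  rw [mem_closure_iff_frequently, not_frequently]
  have hu0 := ne_zero_of_mem_sphere2 hu
  have hcont : Continuous fun w : ℝ × ℝ => dot2 u w := by
    unfold dot2; fun_prop
  filter_upwards [h.1.eventually_unstable hu0, h.2.eventually_unstable hu0,
    (isOpen_lt continuous_const hcont).mem_nhds (dot2_self_pos hu0)] with w h1 h2 h3 hw
  obtain ⟨⟨hws, hwst⟩, hne⟩ := hw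
  rcases lt_trichotomy (cross2 u w) 0 with h0 | h0 | h0
  · exact hwst (h1 (by linarith))
  · exact hne (eq_of_cross2_eq_zero hu hws h0 h3)
  · exact hwst (h2 (by linarith))

lemma IsolatedStable.sideUnstable {𝒰 : Finset (Finset Site)} {u : ℝ × ℝ}
    (h : IsolatedStable 𝒰 u) {σ : ℝ} (hσ : σ ≠ 0) : SideUnstable 𝒰 σ u := by
  obtain ⟨⟨hu, hst⟩, hcl⟩ := h
  by_contra hn
  refine hcl ?_
  set w : ℝ → ℝ × ℝ := fun ε => (√(1 + (σ * ε) ^ 2))⁻¹ • (u + (-(σ * ε)) • (-u.2, u.1)) with hw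
  have hpos : ∀ ε, 0 < √(1 + (σ * ε) ^ 2) := fun ε => Real.sqrt_pos.2 (by positivity)
  have hcont : Continuous w := by
    refine Continuous.smul (Continuous.inv₀ (by fun_prop) fun ε => (hpos ε).ne') (by fun_prop)
  have hlim : Tendsto w (𝓝[>] 0) (𝓝 u) := by
    have h0 : w 0 = u := by simp [hw]
    have := hcont.tendsto 0
    rw [h0] at this
    exact this.mono_left nhdsWithin_le_nhds
  have h1 : u.1 ^ 2 + u.2 ^ 2 = 1 := hu
  refine mem_closure_of_tendsto hlim ?_
  have hev : ∀ᶠ ε : ℝ in 𝓝[>] 0, ∀ U ∈ 𝒰, ∃ x ∈ U,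
      0 ≤ inner2 x u - ε * (σ * cross2 u (realSite x)) := by
    refine (Filter.eventually_all_finset 𝒰).2 fun U hU => ?_
    simp only [SideUnstable] at hn
    push Not at hn
    obtain ⟨x, hx, hx0, hx1⟩ := hn U hU
    rcases hx0.eq_or_lt with hx0 | hx0
    · filter_upwards [self_mem_nhdsWithin] with ε hε
      have := hx1 hx0.symm
      exact ⟨x, hx, by rw [← hx0]; nlinarith [mul_nonneg (le_of_lt hε) (neg_nonneg.2 this)]⟩
    · have hc : Continuous fun ε : ℝ => inner2 x u - ε * (σ * cross2 u (realSite x)) := by fun_prop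
      have := (isOpen_lt continuous_const hc).mem_nhds (x := (0 : ℝ)) (by simpa using hx0)
      filter_upwards [mem_nhdsWithin_of_mem_nhds this] with ε hε
      exact ⟨x, hx, le_of_lt hε⟩
  filter_upwards [hev, self_mem_nhdsWithin] with ε hε hε0
  have hε0 : 0 < ε := hε0
  refine ⟨⟨?_, ?_⟩, ?_⟩
  · have h2 := Real.sq_sqrt (show 0 ≤ 1 + (σ * ε) ^ 2 by positivity)
    simp only [sphere2, hw, Set.mem_ofPred_eq, Prod.smul_fst, Prod.smul_snd, smul_eq_mul,
      Prod.fst_add, Prod.snd_add]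
    have h4 : (√(1 + (σ * ε) ^ 2))⁻¹ ^ 2 * (1 + (σ * ε) ^ 2) = 1 := by
      rw [inv_pow, h2]
      exact inv_mul_cancel₀ (by positivity)
    linear_combination (1 + (σ * ε) ^ 2) * (√(1 + (σ * ε) ^ 2))⁻¹ ^ 2 * h1 + h4
  · refine not_unstable_iff.2 fun U hU => ?_
    obtain ⟨x, hx, h⟩ := hε U hU
    refine ⟨x, hx, ?_⟩
    rw [hw, inner2_smul]
    refine mul_nonneg (inv_nonneg.2 (hpos ε).le) (le_of_le_of_eq h ?_)
    simp only [inner2, cross2, realSite, Prod.fst_add, Prod.snd_add, Prod.smul_fst, Prod.smul_snd,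
      smul_eq_mul]
    ring
  · intro he
    have h2 : cross2 u (w ε) = 0 := by
      rw [Set.mem_singleton_iff.1 he]
      simp only [cross2]; ring
    have h3 : cross2 u (w ε) = (√(1 + (σ * ε) ^ 2))⁻¹ * (-(σ * ε)) := by
      simp only [cross2, hw, Prod.smul_fst, Prod.smul_snd, smul_eq_mul, Prod.fst_add, Prod.snd_add]
      linear_combination (√(1 + (σ * ε) ^ 2))⁻¹ * (-(σ * ε)) * h1
    rw [h3] at h2
    exact mul_ne_zero (inv_ne_zero (hpos ε).ne') (neg_ne_zero.2 (mul_ne_zero hσ hε0.ne')) h2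

lemma isolatedStable_iff {𝒰 : Finset (Finset Site)} {u : ℝ × ℝ} (hu : u ∈ sphere2) :
    IsolatedStable 𝒰 u ↔ ¬ Unstable 𝒰 u ∧ TwoSided 𝒰 u :=
  ⟨fun h => ⟨h.1.2, h.sideUnstable one_ne_zero, h.sideUnstable (neg_ne_zero.2 one_ne_zero)⟩,
    fun h => h.2.isolatedStable hu h.1⟩

/-- At most `k` extra sites suffice to infect infinitely many sites outside the half-plane. -/
def GrowsWith (𝒰 : Finset (Finset Site)) (k : ℕ) (u : ℝ × ℝ) : Prop :=
  ∃ Z : Finset Site, (∀ z ∈ Z, z ∉ halfPlane u) ∧ Z.card ≤ k ∧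
    (bpClosure 𝒰 (halfPlane u ∪ (Z : Set Site)) \ halfPlane u).Infinite

/-- The condition `α(u) ≤ k` for a direction of arbitrary length. -/
def DifficultyLE (𝒰 : Finset (Finset Site)) (k : ℕ) (u : ℝ × ℝ) : Prop :=
  Unstable 𝒰 u ∨ TwoSided 𝒰 u ∧ GrowsWith 𝒰 k u

lemma DifficultyLE.mono {𝒰 : Finset (Finset Site)} {k l : ℕ} (h : k ≤ l) {u : ℝ × ℝ}
    (hu : DifficultyLE 𝒰 k u) : DifficultyLE 𝒰 l u := by
  obtain hu | ⟨hu, Z, h1, h2, h3⟩ := hu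
  · exact Or.inl hu
  · exact Or.inr ⟨hu, Z, h1, h2.trans h, h3⟩

lemma dirDifficulty_le_iff {𝒰 : Finset (Finset Site)} {k : ℕ} {u : ℝ × ℝ} (hu : u ∈ sphere2) :
    dirDifficulty 𝒰 u ≤ k ↔ DifficultyLE 𝒰 k u := by
  rw [dirDifficulty, DifficultyLE, isolatedStable_iff hu]
  by_cases h1 : Unstable 𝒰 u
  · simp [h1]
  by_cases h2 : TwoSided 𝒰 u
  · simp only [h1, h2, if_false, not_false_eq_true, true_and, if_true, false_or, GrowsWith]
    rw [← ENat.lt_add_one_iff (ENat.natCast_ne_top k), sInf_lt_iff]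
    constructor
    · rintro ⟨n, ⟨Z, hZ, hinf, rfl⟩, hlt⟩
      rw [ENat.lt_add_one_iff (ENat.natCast_ne_top k)] at hlt
      exact ⟨Z, hZ, by exact_mod_cast hlt, hinf⟩
    · rintro ⟨Z, hZ, hk, hinf⟩
      refine ⟨_, ⟨Z, hZ, hinf, rfl⟩, ?_⟩
      rw [ENat.lt_add_one_iff (ENat.natCast_ne_top k)]
      exact_mod_cast hk
  · simp [h1, h2]

lemma difficulty_le_iff {𝒰 : Finset (Finset Site)} {k : ℕ} :
    difficulty 𝒰 ≤ k ↔ ∃ v ∈ sphere2, ∀ u ∈ openSemicircle v, DifficultyLE 𝒰 k u := by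
  rw [difficulty, ← ENat.lt_add_one_iff (ENat.natCast_ne_top k)]
  simp only [iInf_lt_iff]
  simp only [ENat.lt_add_one_iff (ENat.natCast_ne_top k), iSup_le_iff, exists_prop]
  exact exists_congr fun v => and_congr_right fun _ =>
    forall₂_congr fun u hu => dirDifficulty_le_iff hu.1

lemma isBadSet_degenerate (𝒰 : Finset (Finset Site)) : IsBadSet 𝒰 (Degenerate 𝒰) where
  of_degenerate _ h := h
  not_unstable _ h := h.1
  smul c u hc h := by
    refine ⟨fun hu => h.1 ?_, fun hu => h.2 ?_⟩
    · simpa only [Unstable, halfPlane_smul hc] using hu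
    · have := hu.smul (inv_pos.2 hc)
      rwa [smul_smul, inv_mul_cancel₀ hc.ne', one_smul] at this

lemma isBadSet_not_unstable (𝒰 : Finset (Finset Site)) :
    IsBadSet 𝒰 fun u => ¬ Unstable 𝒰 u where
  of_degenerate _ h := h.1
  not_unstable _ h := h
  smul c u hc h := by simpa only [Unstable, halfPlane_smul hc] using h

lemma isBadSet_not_difficultyLE (𝒰 : Finset (Finset Site)) (k : ℕ) :
    IsBadSet 𝒰 fun u => ¬ DifficultyLE 𝒰 k u where
  of_degenerate _ h := fun h' => h'.elim h.1 fun h' => h.2 h'.1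
  not_unstable _ h := fun h' => h (Or.inl h')
  smul c u hc h := by
    rintro (h' | ⟨h1, h2⟩)
    · exact h (Or.inl (by simpa only [Unstable, halfPlane_smul hc] using h'))
    · refine h (Or.inr ⟨?_, by simpa only [GrowsWith, halfPlane_smul hc] using h2⟩)
      have := h1.smul (inv_pos.2 hc)
      rwa [smul_smul, inv_mul_cancel₀ hc.ne', one_smul] at this

lemma Critical.exists_not_degenerate {𝒰 : Finset (Finset Site)} (h : Critical 𝒰) :
    ∃ v ∈ sphere2, ∀ u ∈ openSemicircle v, ¬ Degenerate 𝒰 u := by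
  obtain ⟨-, v, hv, hfin⟩ := h
  refine ⟨v, hv, fun u hu hdeg => hdeg.2 ?_⟩
  refine ((isolatedStable_iff hu.1).1 ⟨⟨hu.1, hdeg.1⟩, fun hcl => ?_⟩).2
  have hopen : IsOpen {w : ℝ × ℝ | 0 < w.1 * v.1 + w.2 * v.2} :=
    isOpen_lt continuous_const (by fun_prop)
  rw [mem_closure_iff_frequently] at hcl
  have hclosed : IsClosed ((stableSet 𝒰 ∩ openSemicircle v) \ {u}) :=
    (hfin.subset Set.sdiff_subset).isClosed
  have := hcl.and_eventually (hopen.mem_nhds hu.2)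
  have hu' : u ∈ closure ((stableSet 𝒰 ∩ openSemicircle v) \ {u}) := by
    rw [mem_closure_iff_frequently]
    exact this.mono fun w hw => ⟨⟨hw.1.1, hw.1.1.1, hw.2⟩, hw.1.2⟩
  rw [hclosed.closure_eq] at hu'
  exact hu'.2 rfl

end Directions

/-- The elements of the rules and their negatives. -/
def candidates (L : List (List Site)) : List Site := L.flatten ++ L.flatten.map fun x => -x

/-- The directions to be tested for the centre `v`, up to the sign condition. -/
def directions (L : List (List Site)) (v : Site) : List Site :=
  v :: (candidates L).map quarterTurn

/-- Instability of a lattice direction, for encoded families. -/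
def ListUnstable (L : List (List Site)) (t : Site) : Prop :=
  ∃ U ∈ L, ∀ x ∈ U, height t x < 0

/-- Two-sidedness of a lattice direction, for encoded families. -/
def ListTwoSided (L : List (List Site)) (t : Site) : Prop :=
  (∃ U ∈ L, ∀ x ∈ U, height t x < 0 ∨ height t x = 0 ∧ 0 < height (quarterTurn t) x) ∧
  ∃ U ∈ L, ∀ x ∈ U, height t x < 0 ∨ height t x = 0 ∧ height (quarterTurn t) x < 0

/-- The encoded family is not a valid update family. -/
def ListInvalid (L : List (List Site)) : Prop := L = [] ∨ ∃ U ∈ L, U = [] ∨ (0, 0) ∈ U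

/-- The encoded family is supercritical. -/
def ListSupercritical (L : List (List Site)) : Prop :=
  ∃ v ∈ candidates L, ∀ t ∈ directions L v, 0 < height v t → ListUnstable L t

/-- Every semicircle of the encoded family has a degenerate direction. -/
def ListSubcritical (L : List (List Site)) : Prop :=
  ∀ v ∈ candidates L, ∃ t ∈ directions L v, 0 < height v t ∧ ¬ ListUnstable L t ∧ ¬ ListTwoSided L t

/-- A certificate for an upper bound on the difficulty. -/
def UpperCert (L : List (List Site)) (k : ℕ)
    (F : List ((List Site × List Site × Site) × (List (Site × ℕ) × List (Site × ℕ)))) : Prop :=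
  ∃ v ∈ candidates L, ∀ t ∈ directions L v, 0 < height v t →
    ListUnstable L t ∨ ListTwoSided L t ∧ ∃ c ∈ F, GrowthCert L t k c

/-- A certificate for a lower bound on the difficulty. -/
def LowerCert (L : List (List Site)) (k : ℕ)
    (F : List ((ℕ × ℕ × ℕ) × (List Site × List (List Site × List Site)))) : Prop :=
  ∀ v ∈ candidates L, ∃ t ∈ directions L v, 0 < height v t ∧ ¬ ListUnstable L t ∧
    (¬ ListTwoSided L t ∨ ∃ c ∈ F, BoundCert L t k c)

/-- Values of the difficulty together with certificates. -/
abbrev Certificate : Type :=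
  ℕ × (List ((List Site × List Site × Site) × (List (Site × ℕ) × List (Site × ℕ))) ×
    List ((ℕ × ℕ × ℕ) × (List Site × List (List Site × List Site))))

/-- Either the input is not a critical family or `c` certifies its difficulty. -/
def Certifies (L : List (List Site)) (c : Certificate) : Prop :=
  ListInvalid L ∨ ListSupercritical L ∨ ListSubcritical L ∨
    UpperCert L c.1 c.2.1 ∧ LowerCert L c.1 c.2.2

section Translation

variable {L : List (List Site)}

lemma mem_candidates {v : Site} : v ∈ candidates L ↔ IsCandidate (family L) v := by
  rw [IsCandidate, exists_family]
  simp only [candidates, List.mem_append, List.mem_flatten, List.mem_map, List.mem_toFinset]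
  constructor
  · rintro (⟨U, hU, hv⟩ | ⟨x, ⟨U, hU, hx⟩, rfl⟩)
    · exact ⟨U, hU, v, hv, Or.inl rfl⟩
    · exact ⟨U, hU, x, hx, Or.inr rfl⟩
  · rintro ⟨U, hU, x, hx, h | h⟩
    · exact Or.inl ⟨U, hU, h ▸ hx⟩
    · exact Or.inr ⟨x, ⟨U, hU, hx⟩, h.symm⟩

lemma isTest_iff {v t : Site} :
    IsTest (family L) v t ↔ t ∈ directions L v ∧ 0 < height v t := by
  simp only [IsTest, directions, List.mem_cons, List.mem_map, mem_candidates]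
  refine and_congr_left fun _ => or_congr_right ⟨?_, ?_⟩
  · rintro ⟨x, hx, rfl⟩
    exact ⟨x, hx, rfl⟩
  · rintro ⟨x, hx, rfl⟩
    exact ⟨x, hx, rfl⟩

lemma unstable_realSite {t : Site} :
    Unstable (family L) (realSite t) ↔ ListUnstable L t := by
  rw [Unstable, exists_family, halfPlane_realSite]
  simp [ListUnstable, intHalfPlane, Set.subset_def]

lemma intStable_of_not_unstable {𝒰 : Finset (Finset Site)} {t : Site}
    (h : ¬ Unstable 𝒰 (realSite t)) : IntStable 𝒰 t := by
  intro U hU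
  obtain ⟨x, hx, h⟩ := not_unstable_iff.1 h U hU
  rw [inner2_realSite] at h
  exact ⟨x, hx, by exact_mod_cast h⟩

lemma twoSided_realSite {t : Site} :
    TwoSided (family L) (realSite t) ↔ ListTwoSided L t := by
  have h : ∀ z : ℤ, (0 : ℝ) < -1 * (z : ℝ) ↔ z < 0 := fun z => by
    rw [neg_one_mul, neg_pos]
    exact_mod_cast Iff.rfl
  simp only [TwoSided, SideUnstable, exists_family, ListTwoSided, inner2_realSite, cross2_realSite,
    one_mul, Int.cast_eq_zero, Int.cast_pos, Int.cast_lt_zero, h, List.mem_toFinset]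

lemma growsWith_realSite {𝒰 : Finset (Finset Site)} {k : ℕ} {t : Site} :
    GrowsWith 𝒰 k (realSite t) ↔ ∃ Z : Finset Site, Z.card ≤ k ∧ (∀ z ∈ Z, 0 ≤ height t z) ∧
      (halfClosure 𝒰 t Z \ intHalfPlane t).Infinite := by
  simp only [GrowsWith, halfPlane_realSite, halfClosure]
  refine exists_congr fun Z => ?_
  simp only [intHalfPlane, Set.mem_ofPred_eq, not_lt]
  tauto

lemma growsWith_iff_exists_growthCert {k : ℕ} {t : Site} (ht : t ≠ 0)
    (hst : ¬ Unstable (family L) (realSite t)) :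
    GrowsWith (family L) k (realSite t) ↔ ∃ c, GrowthCert L t k c := by
  rw [growsWith_realSite]
  constructor
  · rintro ⟨Z, hk, hpos, hinf⟩
    exact exists_growthCert ht (intStable_of_not_unstable hst) hk hpos hinf
  · rintro ⟨c, hc⟩
    exact hc.exists_infinite

lemma exists_growsWith {𝒰 : Finset (Finset Site)} {t : Site} (ht : t ≠ 0)
    (h : TwoSided 𝒰 (realSite t)) : ∃ k, GrowsWith 𝒰 k (realSite t) := by
  obtain ⟨D, hD⟩ := siteDist_bound 𝒰
  obtain ⟨U, hU, h⟩ := h.1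
  obtain ⟨Z, hZ, hinf⟩ := exists_infinite_halfClosure ht hD ⟨U, hU, fun x hx => by
    have := h x hx
    rw [inner2_realSite, cross2_realSite, one_mul] at this
    exact_mod_cast this⟩
  exact ⟨Z.card, growsWith_realSite.2 ⟨Z, le_rfl, hZ, hinf⟩⟩

lemma not_listInvalid_iff : ¬ ListInvalid L ↔ IsUpdateFamily (family L) := by
  rw [IsUpdateFamily, forall_family, ListInvalid, not_or]
  refine and_congr ?_ ?_
  · rw [Finset.nonempty_iff_ne_empty, family, Ne, List.toFinset_eq_empty_iff, List.map_eq_nil_iff]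
  · push Not
    refine forall₂_congr fun U _ => and_congr ?_ (by rw [List.mem_toFinset])
    rw [Finset.nonempty_iff_ne_empty, Ne, Ne, List.toFinset_eq_empty_iff]

lemma listSupercritical_iff (hU : IsUpdateFamily (family L)) :
    ListSupercritical L ↔ Supercritical (family L) := by
  have := (isBadSet_not_unstable (family L)).exists_semicircle_iff hU
  simp only [not_not, isTest_iff, and_imp, unstable_realSite, ← mem_candidates] at this
  exact this.symm

lemma not_listSubcritical_iff (hU : IsUpdateFamily (family L)) :
    ¬ ListSubcritical L ↔ ∃ v ∈ sphere2, ∀ u ∈ openSemicircle v, ¬ Degenerate (family L) u := by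
  rw [(isBadSet_degenerate (family L)).exists_semicircle_iff hU]
  simp only [ListSubcritical, isTest_iff, Degenerate, unstable_realSite, twoSided_realSite,
    ← mem_candidates]
  push Not
  simp only [and_imp]

lemma difficulty_le_iff_isTest (hU : IsUpdateFamily (family L)) {k : ℕ} :
    difficulty (family L) ≤ k ↔ ∃ v ∈ candidates L, ∀ t ∈ directions L v, 0 < height v t →
      DifficultyLE (family L) k (realSite t) := by
  have := (isBadSet_not_difficultyLE (family L) k).exists_semicircle_iff hU
  simp only [not_not] at this
  rw [difficulty_le_iff, this]
  simp only [isTest_iff, and_imp, mem_candidates]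

lemma ne_zero_of_height_pos {v t : Site} (h : 0 < height v t) : t ≠ 0 := by
  rintro rfl
  simp [height] at h

lemma UpperCert.difficulty_le (hU : IsUpdateFamily (family L)) {k : ℕ} {F}
    (h : UpperCert L k F) : difficulty (family L) ≤ k := by
  obtain ⟨v, hv, h⟩ := h
  refine (difficulty_le_iff_isTest hU).2 ⟨v, hv, fun t ht hvt => ?_⟩
  by_cases hst : Unstable (family L) (realSite t)
  · exact Or.inl hst
  · obtain ⟨h2, c, -, hc⟩ := (h t ht hvt).resolve_left (unstable_realSite.not.1 hst)
    exact Or.inr ⟨twoSided_realSite.2 h2,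
      (growsWith_iff_exists_growthCert (ne_zero_of_height_pos hvt) hst).2 ⟨c, hc⟩⟩

lemma LowerCert.le_difficulty (hU : IsUpdateFamily (family L)) {k : ℕ} {F}
    (h : LowerCert L k F) : (k : ℕ∞) ≤ difficulty (family L) := by
  by_contra hlt
  rw [not_le] at hlt
  obtain ⟨j, hj⟩ := ENat.ne_top_iff_exists.1 hlt.ne_top
  rw [← hj] at hlt
  have hjk : j < k := by exact_mod_cast hlt
  obtain ⟨v, hv, hD⟩ := (difficulty_le_iff_isTest hU).1 hj.symm.le
  obtain ⟨t, ht, hvt, hst, h⟩ := h v hv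
  rw [← unstable_realSite] at hst
  rw [← twoSided_realSite] at h
  obtain ⟨h2, hG⟩ := (hD t ht hvt).resolve_left hst
  obtain ⟨c, -, hc⟩ := h.resolve_left (not_not.2 h2)
  obtain ⟨Z, hZ, hpos, hinf⟩ := growsWith_realSite.1 hG
  exact hinf (hc.finite (ne_zero_of_height_pos hvt) (intStable_of_not_unstable hst)
    (hZ.trans_lt hjk) hpos)

lemma exists_list_witnesses {α β : Type*} (p : α → β → Prop) (l : List α) :
    ∃ F : List β, ∀ a ∈ l, (∃ b, p a b) → ∃ b ∈ F, p a b := by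
  induction l with
  | nil => exact ⟨[], by simp⟩
  | cons a l ih =>
    obtain ⟨F, hF⟩ := ih
    by_cases h : ∃ b, p a b
    · obtain ⟨b, hb⟩ := h
      refine ⟨b :: F, fun a' ha' h' => ?_⟩
      rcases List.mem_cons.1 ha' with rfl | ha'
      · exact ⟨b, List.mem_cons_self, hb⟩
      · obtain ⟨b', hb', h'⟩ := hF a' ha' h'
        exact ⟨b', List.mem_cons_of_mem _ hb', h'⟩
    · refine ⟨F, fun a' ha' h' => ?_⟩
      rcases List.mem_cons.1 ha' with rfl | ha'
      · exact absurd h' h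
      · exact hF a' ha' h'

lemma exists_upperCert (hU : IsUpdateFamily (family L)) {k : ℕ}
    (h : difficulty (family L) ≤ k) : ∃ F, UpperCert L k F := by
  obtain ⟨v, hv, h⟩ := (difficulty_le_iff_isTest hU).1 h
  obtain ⟨F, hF⟩ := exists_list_witnesses (fun t c => GrowthCert L t k c) (directions L v)
  refine ⟨F, v, hv, fun t ht hvt => ?_⟩
  by_cases hst : Unstable (family L) (realSite t)
  · exact Or.inl (unstable_realSite.1 hst)
  · obtain ⟨h2, hG⟩ := (h t ht hvt).resolve_left hst
    exact Or.inr ⟨twoSided_realSite.1 h2, hF t ht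
      ((growsWith_iff_exists_growthCert (ne_zero_of_height_pos hvt) hst).1 hG)⟩

lemma exists_lowerCert (hU : IsUpdateFamily (family L)) (hsc : ¬ Supercritical (family L)) {k : ℕ}
    (h : (k : ℕ∞) ≤ difficulty (family L)) : ∃ F, LowerCert L k F := by
  obtain ⟨F, hF⟩ := exists_list_witnesses (fun t c => BoundCert L t k c)
    ((candidates L).flatMap (directions L))
  refine ⟨F, fun v hv => ?_⟩
  have hcert : ∀ t ∈ directions L v, 0 < height v t → ¬ Unstable (family L) (realSite t) →
      (∀ j < k, ¬ GrowsWith (family L) j (realSite t)) → ∃ c ∈ F, BoundCert L t k c := by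
    intro t ht hvt hst hG
    refine hF t (List.mem_flatMap.2 ⟨v, hv, ht⟩) (exists_boundCert (ne_zero_of_height_pos hvt)
      (intStable_of_not_unstable hst) (finite_bpClosure hsc) fun Z hZ hpos => ?_)
    by_contra hinf
    exact hG Z.card hZ (growsWith_realSite.2 ⟨Z, le_rfl, hpos, hinf⟩)
  rcases k with _ | j
  · rw [← listSupercritical_iff hU, ListSupercritical] at hsc
    push Not at hsc
    obtain ⟨t, ht, hvt, hst⟩ := hsc v hv
    exact ⟨t, ht, hvt, hst, Or.inr (hcert t ht hvt (unstable_realSite.not.2 hst) (by simp))⟩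
  · have hj : ¬ difficulty (family L) ≤ j := by
      rw [not_le]
      exact lt_of_lt_of_le (by exact_mod_cast j.lt_succ_self) h
    rw [difficulty_le_iff_isTest hU] at hj
    push Not at hj
    obtain ⟨t, ht, hvt, hD⟩ := hj v hv
    refine ⟨t, ht, hvt, fun hst => hD (Or.inl (unstable_realSite.2 hst)), ?_⟩
    by_cases h2 : ListTwoSided L t
    · refine Or.inr (hcert t ht hvt (fun hst => hD (Or.inl hst)) fun i hi hG => hD ?_)
      exact DifficultyLE.mono (Nat.lt_succ_iff.1 hi) (Or.inr ⟨twoSided_realSite.2 h2, hG⟩)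
    · exact Or.inl h2

lemma difficulty_ne_top (hU : IsUpdateFamily (family L)) (h : ¬ ListSubcritical L) :
    difficulty (family L) ≠ ⊤ := by
  simp only [ListSubcritical] at h
  push Not at h
  obtain ⟨v, hv, h⟩ := h
  have key : ∀ l : List Site, ∃ k, ∀ t ∈ l, t ∈ directions L v → 0 < height v t →
      DifficultyLE (family L) k (realSite t) := by
    intro l
    induction l with
    | nil => exact ⟨0, by simp⟩
    | cons a l ih =>
      obtain ⟨k, hk⟩ := ih
      obtain ⟨k', hk'⟩ : ∃ k', a ∈ directions L v → 0 < height v a →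
          DifficultyLE (family L) k' (realSite a) := by
        by_cases ha : a ∈ directions L v ∧ 0 < height v a
        · by_cases hst : ListUnstable L a
          · exact ⟨0, fun _ _ => Or.inl (unstable_realSite.2 hst)⟩
          · have h2 := twoSided_realSite.2 (h a ha.1 ha.2 hst)
            obtain ⟨k', hk'⟩ := exists_growsWith (ne_zero_of_height_pos ha.2) h2
            exact ⟨k', fun _ _ => Or.inr ⟨h2, hk'⟩⟩
        · exact ⟨0, fun h1 h2 => absurd ⟨h1, h2⟩ ha⟩
      refine ⟨max k k', fun t ht h1 h2 => ?_⟩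
      rcases List.mem_cons.1 ht with rfl | ht
      · exact (hk' h1 h2).mono (le_max_right _ _)
      · exact (hk t ht h1 h2).mono (le_max_left _ _)
  obtain ⟨k, hk⟩ := key (directions L v)
  exact ne_top_of_le_ne_top (ENat.natCast_ne_top k)
    ((difficulty_le_iff_isTest hU).2 ⟨v, hv, fun t ht => hk t ht ht⟩)

lemma exists_certifies (L : List (List Site)) : ∃ c, Certifies L c := by
  by_cases h1 : ListInvalid L
  · exact ⟨default, Or.inl h1⟩
  by_cases h2 : ListSupercritical L
  · exact ⟨default, Or.inr (Or.inl h2)⟩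
  by_cases h3 : ListSubcritical L
  · exact ⟨default, Or.inr (Or.inr (Or.inl h3))⟩
  have hU := not_listInvalid_iff.1 h1
  obtain ⟨k, hk⟩ := ENat.ne_top_iff_exists.1 (difficulty_ne_top hU h3)
  obtain ⟨F, hF⟩ := exists_upperCert hU hk.symm.le
  obtain ⟨G, hG⟩ := exists_lowerCert hU ((listSupercritical_iff hU).not.1 h2) hk.le
  exact ⟨(k, F, G), Or.inr (Or.inr (Or.inr ⟨hF, hG⟩))⟩

lemma Certifies.eq_difficulty {c : Certificate} (h : Certifies L c)
    (hU : IsUpdateFamily (family L)) (hc : Critical (family L)) :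
    (c.1 : ℕ∞) = difficulty (family L) := by
  obtain h | h | h | ⟨h, h'⟩ := h
  · exact absurd h (not_listInvalid_iff.2 hU)
  · exact absurd ((listSupercritical_iff hU).1 h) hc.1
  · exact absurd h ((not_listSubcritical_iff hU).2 hc.exists_not_degenerate)
  · exact le_antisymm (h'.le_difficulty hU) (h.difficulty_le hU)

end Translation

section Primrec

variable {α : Type} [Primcodable α] {L : α → List (List Site)} {t : α → Site}

@[fun_prop] lemma primrec_candidates (hL : Primrec L) : Primrec fun a => candidates (L a) := by
  have h : Primrec fun a => (L a).flatten := Primrec.list_flatten.comp hL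
  have h' : Primrec fun a => (L a).flatten.map fun x => -x :=
    Primrec.list_map h (by unfold Primrec₂; fun_prop)
  exact Primrec.list_append.comp h h'

@[fun_prop] lemma primrec_directions (hL : Primrec L) (ht : Primrec t) :
    Primrec fun a => directions (L a) (t a) :=
  Primrec.list_cons.comp ht (Primrec.list_map (primrec_candidates hL) (by unfold Primrec₂; fun_prop))

lemma primrecPred_listUnstable (hL : Primrec L) (ht : Primrec t) :
    PrimrecPred fun a => ListUnstable (L a) (t a) := by
  unfold ListUnstable
  repeat' first
    | fun_prop
    | refine PrimrecPred.all_mem ?_ ?_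
    | refine PrimrecPred.ex_mem ?_ ?_
    | refine PrimrecPred.int_lt ?_ ?_

lemma primrecPred_listTwoSided (hL : Primrec L) (ht : Primrec t) :
    PrimrecPred fun a => ListTwoSided (L a) (t a) := by
  unfold ListTwoSided
  repeat' first
    | fun_prop
    | refine PrimrecPred.all_mem ?_ ?_
    | refine PrimrecPred.ex_mem ?_ ?_
    | refine PrimrecPred.and ?_ ?_
    | refine PrimrecPred.or ?_ ?_
    | refine PrimrecPred.int_lt ?_ ?_
    | refine PrimrecPred.eq' ?_ ?_

lemma primrecPred_listInvalid (hL : Primrec L) : PrimrecPred fun a => ListInvalid (L a) := by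
  unfold ListInvalid
  repeat' first
    | fun_prop
    | refine PrimrecPred.ex_mem ?_ ?_
    | refine PrimrecPred.or ?_ ?_
    | refine PrimrecPred.mem_list ?_ ?_
    | refine PrimrecPred.eq' ?_ ?_

lemma primrecPred_listSupercritical (hL : Primrec L) :
    PrimrecPred fun a => ListSupercritical (L a) := by
  unfold ListSupercritical
  repeat' first
    | fun_prop
    | refine primrecPred_listUnstable ?_ ?_
    | refine PrimrecPred.all_mem ?_ ?_
    | refine PrimrecPred.ex_mem ?_ ?_
    | refine PrimrecPred.int_lt ?_ ?_
    | refine PrimrecPred.imp ?_ ?_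

lemma primrecPred_listSubcritical (hL : Primrec L) :
    PrimrecPred fun a => ListSubcritical (L a) := by
  unfold ListSubcritical
  repeat' first
    | fun_prop
    | refine (primrecPred_listUnstable ?_ ?_).not
    | refine (primrecPred_listTwoSided ?_ ?_).not
    | refine PrimrecPred.all_mem ?_ ?_
    | refine PrimrecPred.ex_mem ?_ ?_
    | refine PrimrecPred.and ?_ ?_
    | refine PrimrecPred.int_lt ?_ ?_

lemma primrecPred_upperCert {k : α → ℕ}
    {F : α → List ((List Site × List Site × Site) × (List (Site × ℕ) × List (Site × ℕ)))}
    (hL : Primrec L) (hk : Primrec k) (hF : Primrec F) :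
    PrimrecPred fun a => UpperCert (L a) (k a) (F a) := by
  unfold UpperCert
  refine PrimrecPred.ex_mem (by fun_prop) (PrimrecPred.all_mem (by fun_prop)
    (PrimrecPred.imp (PrimrecPred.int_lt (by fun_prop) (by fun_prop))
    (PrimrecPred.or (primrecPred_listUnstable (by fun_prop) (by fun_prop)) (PrimrecPred.and
      (primrecPred_listTwoSided (by fun_prop) (by fun_prop)) (PrimrecPred.ex_mem (by fun_prop) ?_)))))
  exact primrecPred_growthCert.comp
    (f := fun q : ((α × Site) × Site) × ((List Site × List Site × Site) ×
      (List (Site × ℕ) × List (Site × ℕ))) => (((L q.1.1.1, q.1.2), k q.1.1.1), q.2)) (by fun_prop)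

lemma primrecPred_lowerCert {k : α → ℕ}
    {F : α → List ((ℕ × ℕ × ℕ) × (List Site × List (List Site × List Site)))}
    (hL : Primrec L) (hk : Primrec k) (hF : Primrec F) :
    PrimrecPred fun a => LowerCert (L a) (k a) (F a) := by
  unfold LowerCert
  refine PrimrecPred.all_mem (by fun_prop) (PrimrecPred.ex_mem (by fun_prop)
    (PrimrecPred.and (PrimrecPred.int_lt (by fun_prop) (by fun_prop))
    (PrimrecPred.and (primrecPred_listUnstable (by fun_prop) (by fun_prop)).not (PrimrecPred.or
      (primrecPred_listTwoSided (by fun_prop) (by fun_prop)).not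
        (PrimrecPred.ex_mem (by fun_prop) ?_)))))
  have h2 : Primrec fun q : ((α × Site) × Site) × ((ℕ × ℕ × ℕ) ×
      (List Site × List (List Site × List Site))) => q.2 := Primrec.snd
  have h11 := Primrec.fst.comp h2
  have h22 := Primrec.snd.comp h2
  exact primrecPred_boundCert (by fun_prop) (by fun_prop) (by fun_prop)
    (Primrec.fst.comp h11) (Primrec.fst.comp (Primrec.snd.comp h11))
    (Primrec.snd.comp (Primrec.snd.comp h11)) (Primrec.fst.comp h22) (Primrec.snd.comp h22)

lemma primrecPred_certifies {c : α → Certificate} (hL : Primrec L) (hc : Primrec c) :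
    PrimrecPred fun a => Certifies (L a) (c a) :=
  (primrecPred_listInvalid hL).or ((primrecPred_listSupercritical hL).or
    ((primrecPred_listSubcritical hL).or ((primrecPred_upperCert hL (Primrec.fst.comp hc)
      (Primrec.fst.comp (Primrec.snd.comp hc))).and
    (primrecPred_lowerCert hL (Primrec.fst.comp hc) (Primrec.snd.comp (Primrec.snd.comp hc))))))

end Primrec

/-- there is a computable function on lists of lists of pairs of
integers which, whenever the list encodes a critical update family `𝒰`, returns
the (finite) difficulty `α(𝒰)`. -/
theorem exists_computable_difficulty :
    ∃ f : List (List (ℤ × ℤ)) → ℕ, Computable f ∧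
      ∀ (L : List (List (ℤ × ℤ))) (𝒰 : Finset (Finset Site)),
        Encodes L 𝒰 → IsUpdateFamily 𝒰 → Critical 𝒰 →
        (f L : ℕ∞) = difficulty 𝒰 := by
  have hdec : Primrec fun n : ℕ => (Encodable.decode (α := Certificate) n).getD default :=
    Primrec.option_getD.comp Primrec.decode (Primrec.const default)
  have hP : ∀ L, ∃ n, Certifies L ((Encodable.decode (α := Certificate) n).getD default) := by
    intro L
    obtain ⟨c, hc⟩ := exists_certifies L
    exact ⟨Encodable.encode c, by rwa [Encodable.encodek]⟩
  have hfind := Computable.find (P := fun (L : List (List Site)) (n : ℕ) =>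
      Certifies L ((Encodable.decode (α := Certificate) n).getD default))
    (primrecPred_certifies Primrec.fst (hdec.comp Primrec.snd)).computablePred hP
  refine ⟨_, (Primrec.fst.comp hdec).to_comp.comp hfind, ?_⟩
  rintro L _ rfl hU hc
  exact (Nat.find_spec (hP L)).eq_difficulty hU hc
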